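/- arXiv:1902.08637 — 2 statements merged into one kernel-verified Lean document; each statement's English description precedes it below -/
import Mathlib

section
/- Let ψ ∈ T_n and let A = (A₁,…,Aₙ) be pairwise commuting generators of uniformly bounded C₀-semigroups T₁,…,Tₙ on a complex Banach space X. Then the operator ψ(A) defined on D(A) = ∩ⱼ D(Aⱼ) by ψ(A)x = c₀x + c₁·Ax + ∫_{ℝ₊ⁿ\{0}} (T(u) − I)x dμ(u) is closable, and its closure is exactly the generator of the C₀-semigroup g(A) given by g_t(A)x = ∫_{ℝ₊ⁿ} T(u)x dν_t(u). -/
open MeasureTheory Filter Topology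

noncomputable section

/-- A (one-parameter) `C₀`-semigroup of bounded operators on `X`. -/
def IsC0Semigroup {X : Type*} [NormedAddCommGroup X] [NormedSpace ℂ X]
    (T : ℝ → X →L[ℂ] X) : Prop :=
  T 0 = 1 ∧ (∀ s t : ℝ, 0 ≤ s → 0 ≤ t → T (s + t) = T s ∘L T t) ∧
    ∀ x : X, Tendsto (fun t => T t x) (𝓝[≥] (0 : ℝ)) (𝓝 x)

/-- `InGenDomain T x y` means `x` belongs to the domain of the infinitesimal generator `A`
of the semigroup `T` and `A x = y`. -/
def InGenDomain {X : Type*} [NormedAddCommGroup X] [NormedSpace ℂ X]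
    (T : ℝ → X →L[ℂ] X) (x y : X) : Prop :=
  Tendsto (fun t : ℝ => t⁻¹ • (T t x - x)) (𝓝[>] (0 : ℝ)) (𝓝 y)

/-- The `n`-parameter semigroup `T(u) = T₁(u₁) ⋯ Tₙ(uₙ)`. -/
def Tprod {X : Type*} [NormedAddCommGroup X] [NormedSpace ℂ X] {n : ℕ}
    (T : Fin n → ℝ → X →L[ℂ] X) (u : Fin n → ℝ) : X →L[ℂ] X :=
  (List.ofFn fun j => T j (u j)).prod

/-- The open negative orthant `(-∞,0)ⁿ`. -/
def negOrthant (n : ℕ) : Set (Fin n → ℝ) := {s | ∀ j, s j < 0}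

/-- The closed nonpositive orthant `(-∞,0]ⁿ`. -/
def nonposOrthant (n : ℕ) : Set (Fin n → ℝ) := {s | ∀ j, s j ≤ 0}

/-- A function of `n` variables is absolutely monotone on `(-∞,0)ⁿ` if it is nonnegative
together with all its iterated partial derivatives there. -/
def AbsMonotoneOn (n : ℕ) (f : (Fin n → ℝ) → ℝ) : Prop :=
  ∀ (k : ℕ) (v : Fin k → Fin n) (s : Fin n → ℝ), s ∈ negOrthant n →
    0 ≤ iteratedFDerivWithin ℝ k f (negOrthant n) s (fun i => Pi.single (v i) 1)

/-- Membership in the class `𝒯ₙ` of (negative) Bernstein functions of `n` variables: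
`ψ` is a nonpositive `C^∞`-function on `(-∞,0)ⁿ` all of whose first-order partial
derivatives are absolutely monotone. -/
def MemTn (n : ℕ) (ψ : (Fin n → ℝ) → ℝ) : Prop :=
  ContDiffOn ℝ (⊤ : ℕ∞) ψ (negOrthant n) ∧ (∀ s ∈ negOrthant n, ψ s ≤ 0) ∧
    ∀ j : Fin n, AbsMonotoneOn n
      (fun s => fderivWithin ℝ ψ (negOrthant n) s (Pi.single j 1))

/-- The Lévy–Khintchine type representation
`ψ(s) = c₀ + c₁·s + ∫ (e^{s·u} - 1) dμ(u)` of a Bernstein function of `n` variables,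
where `c₀ ≤ 0`, `c₁ ∈ ℝ₊ⁿ` and `μ` is a positive measure on `ℝ₊ⁿ \ {0}`. -/
def HasLevyRep (n : ℕ) (ψ : (Fin n → ℝ) → ℝ) (c₀ : ℝ) (c₁ : Fin n → ℝ)
    (μ : Measure (Fin n → ℝ)) : Prop :=
  c₀ ≤ 0 ∧ (∀ j, 0 ≤ c₁ j) ∧ μ {u | ¬ ((∀ j, 0 ≤ u j) ∧ u ≠ 0)} = 0 ∧
    (∀ s ∈ negOrthant n, Integrable (fun u => Real.exp (∑ j, s j * u j) - 1) μ) ∧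
    ∀ s ∈ negOrthant n, ψ s = c₀ + ∑ j, c₁ j * s j +
      ∫ u, (Real.exp (∑ j, s j * u j) - 1) ∂μ

/-- The family of bounded positive measures `ν_t` on `ℝ₊ⁿ` with
`∫ e^{s·u} dν_t(u) = e^{t ψ(s)}` (multidimensional Bernstein–Widder). -/
def IsSubordinator (n : ℕ) (ψ : (Fin n → ℝ) → ℝ) (ν : ℝ → Measure (Fin n → ℝ)) : Prop :=
  ∀ t : ℝ, 0 ≤ t → IsFiniteMeasure (ν t) ∧ (ν t) {u | ¬ ∀ j, 0 ≤ u j} = 0 ∧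
    ∀ s ∈ negOrthant n, ∫ u, Real.exp (∑ j, s j * u j) ∂(ν t) = Real.exp (t * ψ s)

/-- The holomorphic (complex) extension `ψ(λ) = c₀ + c₁·λ + ∫ (e^{λ·u} - 1) dμ(u)`
of a Bernstein function with representation `(c₀, c₁, μ)` to `{Re λ ≤ 0} ⊆ ℂⁿ`. -/
def psiC (n : ℕ) (c₀ : ℝ) (c₁ : Fin n → ℝ) (μ : Measure (Fin n → ℝ))
    (l : Fin n → ℂ) : ℂ :=
  (c₀ : ℂ) + ∑ j, (c₁ j : ℂ) * l j +
    ∫ u, (Complex.exp (∑ j, l j * (u j : ℂ)) - 1) ∂μ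

/-- The joint point spectrum of the tuple of generators of the semigroups `T j`. -/
def JointPointSpectrum {X : Type*} [NormedAddCommGroup X] [NormedSpace ℂ X] {n : ℕ}
    (T : Fin n → ℝ → X →L[ℂ] X) : Set (Fin n → ℂ) :=
  {l | ∃ x : X, x ≠ 0 ∧ ∀ j, InGenDomain (T j) x (l j • x)}

/-- The joint approximate point spectrum of the tuple of generators of the `T j`. -/
def JointApproxSpectrum {X : Type*} [NormedAddCommGroup X] [NormedSpace ℂ X] {n : ℕ}
    (T : Fin n → ℝ → X →L[ℂ] X) : Set (Fin n → ℂ) :=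
  {l | ∃ (x : ℕ → X) (y : Fin n → ℕ → X), (∀ m, ‖x m‖ = 1) ∧
    (∀ j m, InGenDomain (T j) (x m) (y j m)) ∧
    ∀ j, Tendsto (fun m => ‖y j m - l j • x m‖) atTop (𝓝 0)}

/-- The joint residual spectrum of the tuple of generators of the `T j`:
those `λ ∈ ℂⁿ` for which `Σⱼ Im (λⱼ - Aⱼ)` is not dense in `X`. -/
def JointResidualSpectrum {X : Type*} [NormedAddCommGroup X] [NormedSpace ℂ X] {n : ℕ}
    (T : Fin n → ℝ → X →L[ℂ] X) : Set (Fin n → ℂ) :=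
  {l | ¬ Dense (↑(Submodule.span ℂ
      (⋃ j, {z : X | ∃ x y, InGenDomain (T j) x y ∧ z = l j • x - y})) : Set X)}

/-- The point spectrum of a (possibly unbounded) operator given by its graph
relation `R x y ↔ (x ∈ D(B) ∧ B x = y)`. -/
def PointSpec {X : Type*} [NormedAddCommGroup X] [NormedSpace ℂ X]
    (R : X → X → Prop) : Set ℂ :=
  {α | ∃ x : X, x ≠ 0 ∧ R x (α • x)}

/-- The approximate point spectrum of an operator given by its graph relation. -/
def ApproxSpec {X : Type*} [NormedAddCommGroup X] [NormedSpace ℂ X]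
    (R : X → X → Prop) : Set ℂ :=
  {α | ∃ x y : ℕ → X, (∀ m, ‖x m‖ = 1) ∧ (∀ m, R (x m) (y m)) ∧
    Tendsto (fun m => ‖y m - α • x m‖) atTop (𝓝 0)}

/-- The residual spectrum of an operator given by its graph relation:
those `α` for which `Im (α - B)` is not dense. -/
def ResidualSpec {X : Type*} [NormedAddCommGroup X] [NormedSpace ℂ X]
    (R : X → X → Prop) : Set ℂ :=
  {α | ¬ Dense (↑(Submodule.span ℂ {z : X | ∃ x y, R x y ∧ z = α • x - y}) : Set X)}

/-- The resolvent set of a closed operator given by its graph relation: `α` such that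
`α - B : D(B) → X` has a bounded everywhere-defined inverse. -/
def ResolventSet {X : Type*} [NormedAddCommGroup X] [NormedSpace ℂ X]
    (R : X → X → Prop) : Set ℂ :=
  {α | ∃ Rv : X →L[ℂ] X, (∀ z : X, R (Rv z) (α • Rv z - z)) ∧
    ∀ x y : X, R x y → Rv (α • x - y) = x}

/-- The constant `K_M = (M+1)/(1 - e^{-(M+1)/M})` from the moment inequality. -/
def KM (M : ℝ) : ℝ := (M + 1) / (1 - Real.exp (-(M + 1) / M))

/-- The open sector `{z ≠ 0 : |arg z| < θ}` in `ℂ`. -/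
def Sector (θ : ℝ) : Set ℂ := {z | z ≠ 0 ∧ |Complex.arg z| < θ}

/-- A `C₀`-semigroup is holomorphic if it extends to a holomorphic semigroup on some
open sector around the positive half axis, strongly continuous at `0` in the sector. -/
def IsHolomorphicSemigroup {X : Type*} [NormedAddCommGroup X] [NormedSpace ℂ X]
    (T : ℝ → X →L[ℂ] X) : Prop :=
  ∃ (θ : ℝ) (S : ℂ → X →L[ℂ] X), 0 < θ ∧ (∀ t : ℝ, 0 < t → S t = T t) ∧
    (∀ z w : ℂ, z ∈ Sector θ → w ∈ Sector θ → S (z + w) = S z ∘L S w) ∧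
    DifferentiableOn ℂ S (Sector θ) ∧
    ∀ x : X, Tendsto (fun z => S z x) (𝓝[Sector θ] 0) (𝓝 x)

end
def NSG {X : Type*} [NormedAddCommGroup X] [NormedSpace ℂ X]
    (S : ℝ → X →L[ℂ] X) (M : ℝ) : Prop :=
  S 0 = 1 ∧ (∀ s t : ℝ, 0 ≤ s → 0 ≤ t → S (s + t) = S s ∘L S t) ∧
    (∀ x : X, Continuous fun t => S t x) ∧ ∀ t, ‖S t‖ ≤ M

section semigroup
set_option linter.unusedSectionVars false
variable {X : Type*} [NormedAddCommGroup X] [NormedSpace ℂ X]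

lemma NSG.of_c0 {S : ℝ → X →L[ℂ] X} {M : ℝ} (h : IsC0Semigroup S)
    (hb : ∀ t, 0 ≤ t → ‖S t‖ ≤ M) : NSG (fun t => S (max t 0)) M := by
  obtain ⟨h0, hadd, hc⟩ := h
  have hM : 0 ≤ M := (norm_nonneg _).trans (hb 0 le_rfl)
  refine ⟨by simpa using h0, ?_, ?_, fun t => hb _ (le_max_right _ _)⟩
  · intro s t hs ht
    simp only [max_eq_left hs, max_eq_left ht, max_eq_left (add_nonneg hs ht)]
    exact hadd s t hs ht
  · intro x
    have key : ∀ a b : ℝ, 0 ≤ a → a ≤ b → ‖S b x - S a x‖ ≤ M * ‖S (b - a) x - x‖ := by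
      intro a b ha hab
      have : S b x - S a x = S a (S (b - a) x - x) := by
        have := hadd a (b - a) ha (by linarith)
        rw [add_sub_cancel] at this
        rw [this]; simp
      rw [this]
      exact (ContinuousLinearMap.le_opNorm _ _).trans
        (mul_le_mul_of_nonneg_right (hb a ha) (norm_nonneg _))
    have key2 : ∀ a b : ℝ, 0 ≤ a → 0 ≤ b → ‖S b x - S a x‖ ≤ M * ‖S |b - a| x - x‖ := by
      intro a b ha hb'
      rcases le_total a b with hab | hab
      · rw [abs_of_nonneg (by linarith)]; exact key a b ha hab
      · rw [abs_of_nonpos (by linarith), neg_sub, norm_sub_rev]; exact key b a hb' hab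
    rw [continuous_iff_continuousAt]
    intro s
    rw [ContinuousAt, tendsto_iff_norm_sub_tendsto_zero]
    have h1 : Tendsto (fun t : ℝ => |max t 0 - max s 0|) (𝓝 s) (𝓝[≥] 0) := by
      refine tendsto_nhdsWithin_iff.2 ⟨?_, Eventually.of_forall fun t => Set.mem_Ici.2 (abs_nonneg _)⟩
      have : Continuous (fun t : ℝ => |max t 0 - max s 0|) := by fun_prop
      simpa using this.tendsto s
    have h2 : Tendsto (fun t : ℝ => M * ‖S |max t 0 - max s 0| x - x‖) (𝓝 s) (𝓝 0) := by
      have := (tendsto_iff_norm_sub_tendsto_zero.1 ((hc x).comp h1)).const_mul M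
      simpa using this
    exact squeeze_zero (fun t => norm_nonneg _)
      (fun t => key2 _ _ (le_max_right _ _) (le_max_right _ _)) h2

lemma inGen_max {S : ℝ → X →L[ℂ] X} (x y : X) :
    InGenDomain (fun t => S (max t 0)) x y ↔ InGenDomain S x y := by
  unfold InGenDomain
  apply tendsto_congr'
  filter_upwards [self_mem_nhdsWithin] with t ht
  simp [max_eq_left (le_of_lt (Set.mem_Ioi.1 ht))]

lemma inGen_comm {S : ℝ → X →L[ℂ] X} {x y : X} (h : InGenDomain S x y) (B : X →L[ℂ] X)
    (hB : ∀ t, 0 ≤ t → Commute B (S t)) : InGenDomain S (B x) (B y) := by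
  unfold InGenDomain at *
  have := (B.continuous.tendsto y).comp h
  refine this.congr' ?_
  filter_upwards [self_mem_nhdsWithin] with t ht
  have h1 : B (S t x) = S t (B x) := by
    have := congrArg (fun L : X →L[ℂ] X => L x) (hB t (le_of_lt (Set.mem_Ioi.1 ht))).eq
    simpa using this
  have h2 : ∀ z, B (t⁻¹ • z) = t⁻¹ • B z := fun z => by
    exact (B.restrictScalars ℝ).map_smul _ _
  simp [h2, h1]

variable [CompleteSpace X] {S : ℝ → X →L[ℂ] X} {M : ℝ}

lemma NSG.nonneg (h : NSG S M) : 0 ≤ M := (norm_nonneg _).trans (h.2.2.2 0)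

lemma NSG.bound (h : NSG S M) (t : ℝ) (x : X) : ‖S t x‖ ≤ M * ‖x‖ :=
  (ContinuousLinearMap.le_opNorm _ _).trans
        (mul_le_mul_of_nonneg_right (h.2.2.2 t) (norm_nonneg _))

lemma NSG.exists_int (h : NSG S M) : ∃ J : ℝ → X →L[ℂ] X,
    (∀ t x, J t x = ∫ r in (0:ℝ)..t, S r x) ∧ ∀ t, ‖J t‖ ≤ M * |t| := by
  have hi : ∀ x a b, IntervalIntegrable (fun r => S r x) volume a b := fun x a b =>
    (h.2.2.1 x).intervalIntegrable a b
  refine ⟨fun t => LinearMap.mkContinuous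
    { toFun := fun x => ∫ r in (0:ℝ)..t, S r x
      map_add' := fun x y => by
        simp only [map_add]
        exact intervalIntegral.integral_add (hi _ _ _) (hi _ _ _)
      map_smul' := fun c x => by
        simp only [map_smul, RingHom.id_apply]
        exact intervalIntegral.integral_smul c _ } (M * |t|) ?_, fun t x => rfl, fun t => ?_⟩
  · intro x
    have := intervalIntegral.norm_integral_le_of_norm_le_const (a := 0) (b := t)
      (f := fun r => S r x) (C := M * ‖x‖) (fun r _ => h.bound r x)
    simp only [sub_zero] at this
    calc _ ≤ _ := this
      _ = _ := by ring
  · exact LinearMap.mkContinuous_norm_le _ (mul_nonneg h.nonneg (abs_nonneg _)) _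

lemma NSG.weak (h : NSG S M) {x y : X}
    (hw : ∀ φ : X →L[ℝ] ℝ, Tendsto (fun t : ℝ => φ (t⁻¹ • (S t x - x))) (𝓝[>] 0) (𝓝 (φ y)))
    {t : ℝ} (ht : 0 ≤ t) : S t x - x = ∫ r in (0:ℝ)..t, S r y := by
  have hi : ∀ x a b, IntervalIntegrable (fun r => S r x) volume a b := fun x a b =>
    (h.2.2.1 x).intervalIntegrable a b
  rw [← sub_eq_zero]
  refine SeparatingDual.eq_zero_of_forall_dual_eq_zero (R := ℝ) (fun φ => ?_)
  set f : ℝ → ℝ := fun t => φ (S t x) - ∫ r in (0:ℝ)..t, φ (S r y) with hf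
  have hcy : Continuous fun r => φ (S r y) := φ.continuous.comp (h.2.2.1 y)
  have hder : ∀ s, HasDerivAt (fun t => ∫ r in (0:ℝ)..t, φ (S r y)) (φ (S s y)) s := fun s =>
    intervalIntegral.integral_hasDerivAt_right (hcy.intervalIntegrable _ _)
      hcy.stronglyMeasurable.stronglyMeasurableAtFilter hcy.continuousAt
  have hcont : ContinuousOn f (Set.Icc 0 t) := by
    apply Continuous.continuousOn
    exact (φ.continuous.comp (h.2.2.1 x)).sub
      (continuous_iff_continuousAt.2 fun s => (hder s).continuousAt)
  have hd : ∀ s ∈ Set.Ico 0 t, HasDerivWithinAt f 0 (Set.Ici s) s := by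
    intro s hs
    have h1 : HasDerivWithinAt (fun t => φ (S t x)) (φ (S s y)) (Set.Ici s) s := by
      rw [← hasDerivWithinAt_Ioi_iff_Ici, hasDerivWithinAt_iff_tendsto_slope' (by simp)]
      have h2 := hw (φ.comp ((S s).restrictScalars ℝ))
      have h3 : Tendsto (fun r => r - s) (𝓝[>] s) (𝓝[>] 0) := by
        refine tendsto_nhdsWithin_iff.2 ⟨?_, ?_⟩
        · have : Continuous (fun r => r - s) := by fun_prop
          have := this.tendsto s
          rw [sub_self] at this
          exact this.mono_left nhdsWithin_le_nhds
        · filter_upwards [self_mem_nhdsWithin] with r hr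
          simpa using hr
      refine (h2.comp h3).congr' ?_
      filter_upwards [self_mem_nhdsWithin] with r hr
      have hr' : s < r := Set.mem_Ioi.1 hr
      have := h.2.1 s (r - s) hs.1 (by linarith)
      rw [add_sub_cancel] at this
      simp only [Function.comp_apply, slope_def_module, this, map_smul]
      simp
    have h4 := h1.sub (hder s).hasDerivWithinAt
    rw [sub_self] at h4
    exact h4
  have := constant_of_has_deriv_right_zero hcont hd t ⟨ht, le_rfl⟩
  simp only [hf, intervalIntegral.integral_same, h.1, sub_zero] at this
  rw [map_sub, map_sub, ← φ.intervalIntegral_comp_comm (hi _ _ _)]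
  simp only [one_apply_eq_self] at this
  linarith

lemma NSG.strong (h : NSG S M) {x y : X} (hw : InGenDomain S x y)
    {t : ℝ} (ht : 0 ≤ t) : S t x - x = ∫ r in (0:ℝ)..t, S r y :=
  h.weak (fun φ => (φ.continuous.tendsto y).comp hw) ht

lemma NSG.avg_tendsto (h : NSG S M) (y : X) :
    Tendsto (fun t : ℝ => t⁻¹ • ∫ r in (0:ℝ)..t, S r y) (𝓝[>] 0) (𝓝 y) := by
  have hc := h.2.2.1 y
  have hder : HasDerivAt (fun t => ∫ r in (0:ℝ)..t, S r y) (S 0 y) 0 :=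
    intervalIntegral.integral_hasDerivAt_right (hc.intervalIntegrable _ _)
      hc.stronglyMeasurable.stronglyMeasurableAtFilter hc.continuousAt
  have := (hasDerivWithinAt_iff_tendsto_slope' (s := Set.Ioi 0) (by simp)).1
    hder.hasDerivWithinAt
  rw [h.1] at this
  refine this.congr (fun t => ?_)
  simp [slope_def_module]

lemma NSG.of_int (h : NSG S M) {x y : X}
    (hw : ∀ t, 0 ≤ t → S t x - x = ∫ r in (0:ℝ)..t, S r y) : InGenDomain S x y := by
  refine (h.avg_tendsto y).congr' ?_
  filter_upwards [self_mem_nhdsWithin] with t ht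
  rw [hw t (le_of_lt (Set.mem_Ioi.1 ht))]

lemma NSG.closed (h : NSG S M) : IsClosed {p : X × X | InGenDomain S p.1 p.2} := by
  obtain ⟨J, hJ, -⟩ := h.exists_int
  have : {p : X × X | InGenDomain S p.1 p.2} =
      ⋂ t : ℝ, ⋂ _ : 0 ≤ t, {p : X × X | S t p.1 - p.1 = J t p.2} := by
    ext p
    simp only [Set.mem_ofPred_eq, Set.mem_iInter, hJ]
    exact ⟨fun hp t ht => h.strong hp ht, fun hp => h.of_int hp⟩
  rw [this]
  refine isClosed_iInter fun t => isClosed_iInter fun _ => ?_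
  exact isClosed_eq (by fun_prop) (by fun_prop)

lemma NSG.avg_mem (h : NSG S M) (x : X) {t : ℝ} (ht : 0 ≤ t) :
    InGenDomain S (∫ r in (0:ℝ)..t, S r x) (S t x - x) := by
  have hi : ∀ x a b, IntervalIntegrable (fun r => S r x) volume a b := fun x a b =>
    (h.2.2.1 x).intervalIntegrable a b
  have shift : ∀ s t : ℝ, 0 ≤ s → 0 ≤ t →
      (∫ r in (0:ℝ)..t, S r (S s x)) = ∫ r in s..(t + s), S r x := by
    intro s t hs ht
    have := intervalIntegral.integral_comp_add_right (a := 0) (b := t) (fun r => S r x) s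
    rw [zero_add] at this
    rw [← this]
    apply intervalIntegral.integral_congr
    intro r hr
    rw [Set.uIcc_of_le ht] at hr
    simp [h.2.1 r s hr.1 hs]
  refine h.of_int fun s hs => ?_
  have e1 : S s (∫ r in (0:ℝ)..t, S r x) = ∫ r in (0:ℝ)..t, S r (S s x) := by
    rw [← (S s).intervalIntegral_comp_comm (hi _ _ _)]
    apply intervalIntegral.integral_congr
    intro r hr
    rw [Set.uIcc_of_le ht] at hr
    have a1 := h.2.1 r s hr.1 hs
    have a2 := h.2.1 s r hs hr.1
    rw [add_comm, a1] at a2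
    have := congrArg (fun L : X →L[ℂ] X => L x) a2
    simpa using this.symm
  have e2 : (∫ r in (0:ℝ)..s, S r (S t x - x)) = (∫ r in (0:ℝ)..s, S r (S t x)) -
      ∫ r in (0:ℝ)..s, S r x := by
    simp only [map_sub]
    exact intervalIntegral.integral_sub (hi _ _ _) (hi _ _ _)
  rw [e1, e2, shift s t hs ht, shift t s ht hs, add_comm t s]
  have e3 := intervalIntegral.integral_add_adjacent_intervals (hi x 0 s) (hi x s (s + t))
  have e4 := intervalIntegral.integral_add_adjacent_intervals (hi x 0 t) (hi x t (s + t))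
  rw [← e4] at e3
  rw [sub_eq_sub_iff_add_eq_add, add_comm, e3, add_comm]

end semigroup
section weakconv

lemma tendsto_approx {l : Filter ℝ} {x : ℝ → ℝ} {x0 : ℝ}
    (H : ∀ ε > 0, ∃ (a b : ℝ → ℝ) (a0 b0 : ℝ), Tendsto a l (𝓝 a0) ∧ Tendsto b l (𝓝 b0) ∧
      (∀ᶠ t in l, |x t - a t| ≤ b t) ∧ |x0 - a0| ≤ b0 ∧ b0 < ε) : Tendsto x l (𝓝 x0) := by
  rw [Metric.tendsto_nhds]
  intro ε hε
  obtain ⟨a, b, a0, b0, ha, hb, hxa, hx0, hb0⟩ := H (ε / 3) (by positivity)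
  filter_upwards [hxa, Metric.tendsto_nhds.1 ha (ε / 3) (by positivity),
    (hb.eventually (gt_mem_nhds hb0))] with t h1 h2 h3
  rw [Real.dist_eq] at h2 ⊢
  rw [abs_le] at h1 hx0
  rw [abs_lt] at h2 ⊢
  constructor <;> linarith

noncomputable def Emap (n : ℕ) (u : Fin n → ℝ) : Fin n → unitInterval := fun j =>
  ⟨Real.exp (-max (u j) 0), (Real.exp_pos _).le, Real.exp_le_one_iff.2 (by simp)⟩

lemma Emap_cont (n : ℕ) : Continuous (Emap n) := by
  unfold Emap
  fun_prop

lemma integrable_of_bdd_cont {n : ℕ} {m : Measure (Fin n → ℝ)} [IsFiniteMeasure m]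
    {E : Type*} [NormedAddCommGroup E]
    {F : (Fin n → ℝ) → E} (hF : Continuous F) {C : ℝ} (hC : ∀ u, ‖F u‖ ≤ C) : Integrable F m :=
  Integrable.of_bound hF.aestronglyMeasurable C (Eventually.of_forall hC)

lemma weak_conv_poly {n : ℕ} {l : Filter ℝ} (ρ : ℝ → Measure (Fin n → ℝ))
    (ρ0 : Measure (Fin n → ℝ)) [IsFiniteMeasure ρ0]
    (hfin : ∀ᶠ t in l, IsFiniteMeasure (ρ t))
    (hs : ∀ᶠ t in l, ∀ᵐ u ∂(ρ t), ∀ j, 0 ≤ u j) (hs0 : ∀ᵐ u ∂ρ0, ∀ j, 0 ≤ u j)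
    (hL : ∀ k : Fin n → ℕ, Tendsto (fun t => ∫ u, Real.exp (∑ j, (-(k j : ℝ)) * u j) ∂(ρ t)) l
      (𝓝 (∫ u, Real.exp (∑ j, (-(k j : ℝ)) * u j) ∂ρ0)))
    (p : C(Fin n → unitInterval, ℝ)) :
    Tendsto (fun t => ∫ u, p (Emap n u) ∂(ρ t)) l (𝓝 (∫ u, p (Emap n u) ∂ρ0)) := by
  have hint : ∀ (p : C(Fin n → unitInterval, ℝ)) (m : Measure (Fin n → ℝ)) [IsFiniteMeasure m],
      Integrable (fun u => p (Emap n u)) m := fun p m _ =>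
    integrable_of_bdd_cont (p.continuous.comp (Emap_cont n)) (fun u => p.norm_coe_le_norm _)
  let c : Fin n → C(Fin n → unitInterval, ℝ) := fun j => ⟨fun z => (z j : ℝ), by fun_prop⟩
  have hpoly : ∀ q : MvPolynomial (Fin n) ℝ,
      Tendsto (fun t => ∫ u, (MvPolynomial.aeval c q) (Emap n u) ∂(ρ t)) l
        (𝓝 (∫ u, (MvPolynomial.aeval c q) (Emap n u) ∂ρ0)) := by
    intro q
    induction q using MvPolynomial.induction_on' with
    | monomial k a =>
      have e : ∀ u : Fin n → ℝ, (∀ j, 0 ≤ u j) →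
          (MvPolynomial.aeval c (MvPolynomial.monomial k a)) (Emap n u)
            = a * Real.exp (∑ j, (-(k j : ℝ)) * u j) := by
        intro u hu
        rw [MvPolynomial.aeval_monomial, Finsupp.prod_fintype _ _ (by simp), Real.exp_sum]
        simp only [ContinuousMap.mul_apply, ContinuousMap.prod_apply, ContinuousMap.pow_apply, c, Emap, ContinuousMap.coe_mk]
        have ea : (algebraMap ℝ C(Fin n → unitInterval, ℝ)) a (Emap n u) = a := by
          simp [Algebra.algebraMap_eq_smul_one]
        rw [ea]
        congr 1
        refine Finset.prod_congr rfl fun j _ => ?_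
        rw [← Real.exp_nat_mul, max_eq_left (hu j)]
        congr 1; ring
      have := (hL k).const_mul a
      rw [integral_congr_ae (g := fun u => a * Real.exp (∑ j, (-(k j : ℝ)) * u j))
        (hs0.mono fun u hu => e u hu), integral_const_mul]
      refine this.congr' ?_
      filter_upwards [hs] with t ht
      rw [integral_congr_ae (g := fun u => a * Real.exp (∑ j, (-(k j : ℝ)) * u j))
        (ht.mono fun u hu => e u hu), integral_const_mul]
    | add q1 q2 h1 h2 =>
      simp only [map_add, ContinuousMap.add_apply]
      rw [integral_add (hint _ _) (hint _ _)]
      refine (h1.add h2).congr' ?_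
      filter_upwards [hfin] with t ht
      rw [integral_add (hint _ _) (hint _ _)]
  have hmass : Tendsto (fun t => (ρ t).real Set.univ) l (𝓝 (ρ0.real Set.univ)) := by
    simpa using hL 0
  apply tendsto_approx
  intro ε hε
  set m0 := ρ0.real Set.univ with hm0
  have hm0' : 0 ≤ m0 := measureReal_nonneg
  let A : Subalgebra ℝ C(Fin n → unitInterval, ℝ) := (MvPolynomial.aeval (R := ℝ) c).range
  have hsep : A.SeparatesPoints := by
    intro z w hzw
    obtain ⟨j, hj⟩ := Function.ne_iff.1 hzw
    refine ⟨c j, ⟨c j, ⟨MvPolynomial.X j, by simp⟩, rfl⟩, ?_⟩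
    simpa [c, Subtype.ext_iff] using hj
  have hδ : 0 < ε / (m0 + 1) := by positivity
  obtain ⟨⟨q, ⟨q', hq'⟩⟩, hq⟩ :=
    ContinuousMap.exists_mem_subalgebra_near_continuousMap_of_separatesPoints A hsep p _ hδ
  have hq' : (MvPolynomial.aeval c) q' = q := hq'
  have hest : ∀ (m : Measure (Fin n → ℝ)) [IsFiniteMeasure m],
      |∫ u, p (Emap n u) ∂m - ∫ u, q (Emap n u) ∂m| ≤ ε / (m0 + 1) * m.real Set.univ := by
    intro m _
    rw [← integral_sub (hint _ _) (hint _ _), ← Real.norm_eq_abs]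
    apply norm_integral_le_of_norm_le_const
    refine Eventually.of_forall fun u => ?_
    have h1 := ((q : C(Fin n → unitInterval, ℝ)) - p).norm_coe_le_norm (Emap n u)
    rw [norm_sub_rev]
    simp only [ContinuousMap.sub_apply] at h1
    exact h1.trans hq.le
  refine ⟨fun t => ∫ u, q (Emap n u) ∂(ρ t), fun t => ε / (m0 + 1) * (ρ t).real Set.univ,
    ∫ u, q (Emap n u) ∂ρ0, ε / (m0 + 1) * m0, ?_, hmass.const_mul _, ?_, hest ρ0, ?_⟩
  · rw [← hq']; exact hpoly q'
  · filter_upwards [hfin] with t ht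
    exact hest _
  · rw [div_mul_eq_mul_div, div_lt_iff₀ (by positivity)]
    nlinarith

lemma weak_conv {n : ℕ} {l : Filter ℝ} (ρ : ℝ → Measure (Fin n → ℝ))
    (ρ0 : Measure (Fin n → ℝ)) [IsFiniteMeasure ρ0]
    (hfin : ∀ᶠ t in l, IsFiniteMeasure (ρ t))
    (hs : ∀ᶠ t in l, ∀ᵐ u ∂(ρ t), ∀ j, 0 ≤ u j) (hs0 : ∀ᵐ u ∂ρ0, ∀ j, 0 ≤ u j)
    (hL : ∀ k : Fin n → ℕ, Tendsto (fun t => ∫ u, Real.exp (∑ j, (-(k j : ℝ)) * u j) ∂(ρ t)) l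
      (𝓝 (∫ u, Real.exp (∑ j, (-(k j : ℝ)) * u j) ∂ρ0)))
    (F : (Fin n → ℝ) → ℝ) (hF : Continuous F) (C : ℝ) (hC : ∀ u, |F u| ≤ C) :
    Tendsto (fun t => ∫ u, F u ∂(ρ t)) l (𝓝 (∫ u, F u ∂ρ0)) := by
  have hpol := weak_conv_poly ρ ρ0 hfin hs hs0 hL
  have hC0 : 0 ≤ C := (abs_nonneg _).trans (hC 0)
  have hint : ∀ (p : C(Fin n → unitInterval, ℝ)) (m : Measure (Fin n → ℝ)) [IsFiniteMeasure m],
      Integrable (fun u => p (Emap n u)) m := fun p m _ =>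
    integrable_of_bdd_cont (p.continuous.comp (Emap_cont n)) (fun u => p.norm_coe_le_norm _)
  let r : ℕ → C(Fin n → unitInterval, ℝ) := fun m =>
    ⟨fun z => (1 - ∏ j, (z j : ℝ)) ^ m, by fun_prop⟩
  have hprod : ∀ z : Fin n → unitInterval, 0 ≤ ∏ j, (z j : ℝ) ∧ ∏ j, (z j : ℝ) ≤ 1 := fun z =>
    ⟨Finset.prod_nonneg fun j _ => (z j).2.1,
      Finset.prod_le_one (fun j _ => (z j).2.1) (fun j _ => (z j).2.2)⟩
  have hr01 : ∀ m z, 0 ≤ r m z ∧ r m z ≤ 1 := fun m z =>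
    ⟨pow_nonneg (by linarith [(hprod z).2]) _,
      pow_le_one₀ (by linarith [(hprod z).2]) (by linarith [(hprod z).1])⟩
  have hpc : ∀ m, Continuous fun z : Fin n → unitInterval =>
      F (fun j => -Real.log (z j)) * (1 - r m z) := by
    intro m
    rw [continuous_iff_continuousAt]
    intro z
    by_cases hz : ∀ j, (z j : ℝ) ≠ 0
    · refine ContinuousAt.mul (ContinuousAt.comp (g := F) hF.continuousAt ?_)
        (by fun_prop)
      refine continuousAt_pi.2 fun j => ContinuousAt.neg ?_
      refine ContinuousAt.log (Continuous.continuousAt (by fun_prop)) (hz j)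
    · push Not at hz
      obtain ⟨j, hj⟩ := hz
      have hz0 : (1 - r m z) = 0 := by
        have : ∏ j, (z j : ℝ) = 0 := Finset.prod_eq_zero (Finset.mem_univ j) hj
        simp [r, this]
      have h1 : Tendsto (fun w => C * (1 - r m w)) (𝓝 z) (𝓝 0) := by
        have : Continuous (fun w => C * (1 - r m w)) := by fun_prop
        simpa [hz0] using this.tendsto z
      rw [ContinuousAt, hz0, mul_zero]
      refine squeeze_zero_norm (fun w => ?_) h1
      rw [norm_mul, Real.norm_eq_abs, Real.norm_eq_abs, abs_of_nonneg (a := 1 - r m w)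
        (by linarith [(hr01 m w).2])]
      exact mul_le_mul_of_nonneg_right (hC _) (by linarith [(hr01 m w).2])
  let p : ℕ → C(Fin n → unitInterval, ℝ) := fun m => ⟨_, hpc m⟩
  have hpE : ∀ m (u : Fin n → ℝ), (∀ j, 0 ≤ u j) →
      p m (Emap n u) = F u * (1 - r m (Emap n u)) := by
    intro m u hu
    have : (fun j => -Real.log (Emap n u j)) = u := by
      funext j
      simp [Emap, hu j]
    simp only [p, ContinuousMap.coe_mk, this]
  have hest : ∀ (m : ℕ) (κ : Measure (Fin n → ℝ)) [IsFiniteMeasure κ],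
      (∀ᵐ u ∂κ, ∀ j, 0 ≤ u j) →
      |∫ u, F u ∂κ - ∫ u, p m (Emap n u) ∂κ| ≤ C * ∫ u, r m (Emap n u) ∂κ := by
    intro m κ _ hκ
    rw [← integral_sub (integrable_of_bdd_cont hF hC) (hint _ _), ← Real.norm_eq_abs,
      ← integral_const_mul]
    refine norm_integral_le_of_norm_le ((hint _ _).const_mul _) ?_
    filter_upwards [hκ] with u hu
    rw [hpE m u hu]
    have : F u - F u * (1 - r m (Emap n u)) = F u * r m (Emap n u) := by ring
    rw [this, norm_mul, Real.norm_eq_abs, Real.norm_eq_abs, abs_of_nonneg (hr01 m _).1]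
    exact mul_le_mul_of_nonneg_right (hC _) (hr01 m _).1
  have hlim : Tendsto (fun m => C * ∫ u, r m (Emap n u) ∂ρ0) atTop (𝓝 0) := by
    have : Tendsto (fun m => ∫ u, r m (Emap n u) ∂ρ0) atTop (𝓝 (∫ u, (0:ℝ) ∂ρ0)) := by
      refine tendsto_integral_of_dominated_convergence (fun _ => 1)
        (fun m => (hint _ _).aestronglyMeasurable) (integrable_const _) ?_ ?_
      · intro m
        refine Eventually.of_forall fun u => ?_
        rw [Real.norm_eq_abs, abs_of_nonneg (hr01 m _).1]
        exact (hr01 m _).2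
      · refine Eventually.of_forall fun u => ?_
        refine tendsto_pow_atTop_nhds_zero_of_lt_one (by linarith [(hprod (Emap n u)).2]) ?_
        have : 0 < ∏ j, (Emap n u j : ℝ) := Finset.prod_pos fun j _ => Real.exp_pos _
        linarith
    simpa using this.const_mul C
  apply tendsto_approx
  intro ε hε
  obtain ⟨m, hm⟩ := (hlim.eventually (gt_mem_nhds hε)).exists
  refine ⟨fun t => ∫ u, p m (Emap n u) ∂(ρ t), fun t => C * ∫ u, r m (Emap n u) ∂(ρ t),
    _, _, hpol (p m), (hpol (r m)).const_mul C, ?_, hest m ρ0 hs0, hm⟩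
  filter_upwards [hfin, hs] with t ht ht'
  exact hest m _ ht'

end weakconv
section levy
variable {n : ℕ} {ψ : (Fin n → ℝ) → ℝ} {c₀ : ℝ} {c₁ : Fin n → ℝ} {μ : Measure (Fin n → ℝ)}
  {ν : ℝ → Measure (Fin n → ℝ)}

noncomputable def psiE (c₀ : ℝ) (c₁ : Fin n → ℝ) (μ : Measure (Fin n → ℝ)) (s : Fin n → ℝ) : ℝ :=
  c₀ + ∑ j, c₁ j * s j + ∫ u, (Real.exp (∑ j, s j * u j) - 1) ∂μ

lemma levy_ae (h : HasLevyRep n ψ c₀ c₁ μ) : ∀ᵐ u ∂μ, ∀ j, 0 ≤ u j := by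
  have h1 : ∀ᵐ u ∂μ, (∀ j, 0 ≤ u j) ∧ u ≠ 0 := by
    rw [ae_iff]; exact h.2.2.1
  exact h1.mono fun u hu => hu.1

lemma sub_ae (h : IsSubordinator n ψ ν) {t : ℝ} (ht : 0 ≤ t) : ∀ᵐ u ∂(ν t), ∀ j, 0 ≤ u j := by
  rw [ae_iff]; exact (h t ht).2.1

lemma sum_nonpos' {s u : Fin n → ℝ} (hs : ∀ j, s j ≤ 0) (hu : ∀ j, 0 ≤ u j) :
    ∑ j, s j * u j ≤ 0 :=
  Finset.sum_nonpos fun j _ => mul_nonpos_of_nonpos_of_nonneg (hs j) (hu j)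

lemma levy_dom {s s' u : Fin n → ℝ} (hs' : ∀ j, s' j ≤ 0) (h : ∀ j, s j ≤ s' j)
    (hu : ∀ j, 0 ≤ u j) :
    ‖Real.exp (∑ j, s' j * u j) - 1‖ ≤ ‖Real.exp (∑ j, s j * u j) - 1‖ := by
  have h1 := Real.exp_le_one_iff.2 (sum_nonpos' hs' hu)
  have h2 : Real.exp (∑ j, s j * u j) ≤ Real.exp (∑ j, s' j * u j) :=
    Real.exp_le_exp.2 (Finset.sum_le_sum fun j _ => mul_le_mul_of_nonneg_right (h j) (hu j))
  rw [Real.norm_eq_abs, Real.norm_eq_abs, abs_of_nonpos (by linarith), abs_of_nonpos (by linarith)]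
  linarith

lemma levy_int (h : HasLevyRep n ψ c₀ c₁ μ) {s : Fin n → ℝ} (hs : ∀ j, s j ≤ 0) :
    Integrable (fun u => Real.exp (∑ j, s j * u j) - 1) μ := by
  have hneg : (fun j => s j - 1) ∈ negOrthant n := by
    intro j; have := hs j; linarith
  have h1 := h.2.2.2.1 _ hneg
  refine h1.mono (Continuous.aestronglyMeasurable (by fun_prop)) ?_
  filter_upwards [levy_ae h] with u hu
  exact levy_dom hs (fun j => by linarith) hu

lemma seq_tendsto (a : ℝ) : Tendsto (fun m : ℕ => a - 1 / ((m : ℝ) + 1)) atTop (𝓝 a) := by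
  simpa using (tendsto_const_nhds (x := a)).sub tendsto_one_div_add_atTop_nhds_zero_nat

lemma seq_le (m : ℕ) : 1 / ((m : ℝ) + 1) ≤ 1 := by
  rw [div_le_one (by positivity)]
  have : (0 : ℝ) ≤ m := Nat.cast_nonneg m
  linarith

lemma psiE_tendsto (h : HasLevyRep n ψ c₀ c₁ μ) {s : Fin n → ℝ} (hs : ∀ j, s j ≤ 0) :
    Tendsto (fun m : ℕ => psiE c₀ c₁ μ (fun j => s j - 1 / ((m : ℝ) + 1))) atTop
      (𝓝 (psiE c₀ c₁ μ s)) := by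
  unfold psiE
  refine Tendsto.add (Tendsto.add tendsto_const_nhds
    (tendsto_finsetSum _ fun j _ => (seq_tendsto (s j)).const_mul _)) ?_
  have hneg : ∀ j, s j - 1 ≤ 0 := fun j => by have := hs j; linarith
  refine tendsto_integral_of_dominated_convergence
    (fun u => ‖Real.exp (∑ j, (s j - 1) * u j) - 1‖)
    (fun m => (Continuous.aestronglyMeasurable (by fun_prop))) (levy_int h hneg).norm ?_ ?_
  · intro m
    filter_upwards [levy_ae h] with u hu
    refine levy_dom (fun j => ?_) (fun j => ?_) hu
    · have := hs j
      have : 0 < 1 / ((m : ℝ) + 1) := by positivity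
      linarith
    · have := seq_le m
      linarith
  · refine Eventually.of_forall fun u => ?_
    refine Tendsto.sub_const ?_ _
    refine (Real.continuous_exp.tendsto _).comp ?_
    exact tendsto_finsetSum _ fun j _ => (seq_tendsto (s j)).mul_const _

lemma laplace (h : HasLevyRep n ψ c₀ c₁ μ) (hν : IsSubordinator n ψ ν) {t : ℝ} (ht : 0 ≤ t)
    {s : Fin n → ℝ} (hs : ∀ j, s j ≤ 0) :
    ∫ u, Real.exp (∑ j, s j * u j) ∂(ν t) = Real.exp (t * psiE c₀ c₁ μ s) := by
  have h1 := (Real.continuous_exp.tendsto _).comp ((psiE_tendsto h hs).const_mul t)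
  have := (hν t ht).1
  have hneg : ∀ m : ℕ, ∀ j, s j - 1 / ((m : ℝ) + 1) < 0 := by
    intro m j
    have := hs j
    have : 0 < 1 / ((m : ℝ) + 1) := by positivity
    linarith
  refine tendsto_nhds_unique ?_ h1
  have h2 : ∀ m : ℕ, Real.exp (t * psiE c₀ c₁ μ (fun j => s j - 1 / ((m : ℝ) + 1))) =
      ∫ u, Real.exp (∑ j, (s j - 1 / ((m : ℝ) + 1)) * u j) ∂(ν t) := by
    intro m
    have hm : (fun j => s j - 1 / ((m : ℝ) + 1)) ∈ negOrthant n := hneg m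
    rw [(hν t ht).2.2 _ hm, h.2.2.2.2 _ hm]; rfl
  simp only [Function.comp_def, h2]
  refine tendsto_integral_of_dominated_convergence (fun _ => 1)
    (fun m => (Continuous.aestronglyMeasurable (by fun_prop))) (integrable_const _) ?_ ?_
  · intro m
    filter_upwards [sub_ae hν ht] with u hu
    rw [Real.norm_eq_abs, Real.abs_exp]
    exact Real.exp_le_one_iff.2 (sum_nonpos' (fun j => (hneg m j).le) hu)
  · refine Eventually.of_forall fun u => ?_
    refine (Real.continuous_exp.tendsto _).comp ?_
    exact tendsto_finsetSum _ fun j _ => (seq_tendsto (s j)).mul_const _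

lemma exp_split (s u : Fin n → ℝ) (j : Fin n) :
    (1 - Real.exp (-(u j))) * Real.exp (∑ i, s i * u i) =
      Real.exp (∑ i, s i * u i) - Real.exp (∑ i, (s i - (Pi.single j 1 : Fin n → ℝ) i) * u i) := by
  have : ∑ i, (s i - (Pi.single j 1 : Fin n → ℝ) i) * u i = -(u j) + ∑ i, s i * u i := by
    simp only [sub_mul, Finset.sum_sub_distrib]
    rw [Finset.sum_eq_single (f := fun i => (Pi.single j 1 : Fin n → ℝ) i * u i) j]
    · simp; ring
    · intro i _ hi; simp [hi]
    · simp
  rw [this, Real.exp_add]; ring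

noncomputable def wd (κ : Measure (Fin n → ℝ)) (j : Fin n) (c : ℝ) : Measure (Fin n → ℝ) :=
  κ.withDensity (fun u => (Real.toNNReal (c * (1 - Real.exp (-(u j)))) : ENNReal))

lemma wd_meas (j : Fin n) (c : ℝ) :
    Measurable fun u : Fin n → ℝ => Real.toNNReal (c * (1 - Real.exp (-(u j)))) := by
  apply Measurable.real_toNNReal
  exact (Continuous.measurable (by fun_prop))

lemma one_sub_nonneg {u : Fin n → ℝ} (j : Fin n) (hu : ∀ j, 0 ≤ u j) :
    0 ≤ 1 - Real.exp (-(u j)) := by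
  have := Real.exp_le_one_iff.2 (neg_nonpos.2 (hu j)); linarith

lemma wd_integral {κ : Measure (Fin n → ℝ)} (hκ : ∀ᵐ u ∂κ, ∀ j, 0 ≤ u j) (j : Fin n) {c : ℝ}
    (hc : 0 ≤ c) (F : (Fin n → ℝ) → ℝ) :
    ∫ u, F u ∂(wd κ j c) = c * ∫ u, (1 - Real.exp (-(u j))) * F u ∂κ := by
  unfold wd
  rw [integral_withDensity_eq_integral_smul (wd_meas j c), ← integral_const_mul]
  apply integral_congr_ae
  filter_upwards [hκ] with u hu
  rw [NNReal.smul_def, Real.coe_toNNReal _ (mul_nonneg hc (one_sub_nonneg j hu)), smul_eq_mul]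
  ring

lemma wd_ae {κ : Measure (Fin n → ℝ)} (hκ : ∀ᵐ u ∂κ, ∀ j, 0 ≤ u j) (j : Fin n) (c : ℝ) :
    ∀ᵐ u ∂(wd κ j c), ∀ j, 0 ≤ u j :=
  (withDensity_absolutelyContinuous _ _).ae_le hκ

lemma wd_fin {κ : Measure (Fin n → ℝ)} (j : Fin n) (c : ℝ)
    (h : Integrable (fun u => 1 - Real.exp (-(u j))) κ) : IsFiniteMeasure (wd κ j c) :=
  isFiniteMeasure_withDensity_ofReal (h.const_mul c).2

lemma exp_deriv0 (a : ℝ) : Tendsto (fun t : ℝ => t⁻¹ * (Real.exp (t * a) - 1)) (𝓝[>] 0) (𝓝 a) := by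
  have h : HasDerivAt (fun t : ℝ => Real.exp (t * a)) a 0 := by
    simpa using ((hasDerivAt_id (0:ℝ)).mul_const a).exp
  have := (hasDerivWithinAt_iff_tendsto_slope' (s := Set.Ioi 0) (by simp)).1 h.hasDerivWithinAt
  refine this.congr fun t => ?_
  simp [slope_def_module]

lemma levy_int_j (h : HasLevyRep n ψ c₀ c₁ μ) (j : Fin n) :
    Integrable (fun u => 1 - Real.exp (-(u j))) μ := by
  have h1 := (levy_int h (s := fun i => -(Pi.single j 1 : Fin n → ℝ) i) (fun i => by
    by_cases hi : i = j
    · subst hi; simp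
    · simp [hi])).neg
  refine h1.congr (Eventually.of_forall fun u => ?_)
  have := exp_split 0 u j
  simp only [Pi.zero_apply, zero_mul, Finset.sum_const_zero, Real.exp_zero, mul_one, zero_sub]
    at this
  simp only [Pi.neg_apply]
  rw [this]; ring

lemma rho_conv (h : HasLevyRep n ψ c₀ c₁ μ) (hν : IsSubordinator n ψ ν) (j : Fin n)
    (F : (Fin n → ℝ) → ℝ) (hF : Continuous F) (C : ℝ) (hC : ∀ u, |F u| ≤ C) :
    Tendsto (fun t => t⁻¹ * ∫ u, (1 - Real.exp (-(u j))) * F u ∂(ν t)) (𝓝[>] 0)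
      (𝓝 (c₁ j * F 0 + ∫ u, (1 - Real.exp (-(u j))) * F u ∂μ)) := by
  have hμae := levy_ae h
  have : IsFiniteMeasure (wd μ j 1) := wd_fin j 1 (levy_int_j h j)
  have : IsFiniteMeasure (ENNReal.ofReal (c₁ j) • Measure.dirac (0 : Fin n → ℝ)) :=
    Measure.smul_finite _ ENNReal.ofReal_ne_top
  set ρ0 := ENNReal.ofReal (c₁ j) • Measure.dirac (0 : Fin n → ℝ) + wd μ j 1 with hρ0
  have hρ0i : ∀ (G : (Fin n → ℝ) → ℝ) (C : ℝ), Continuous G → (∀ᵐ u ∂(wd μ j 1), |G u| ≤ C) →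
      ∫ u, G u ∂ρ0 = c₁ j * G 0 + ∫ u, (1 - Real.exp (-(u j))) * G u ∂μ := by
    intro G C hG hGC
    rw [hρ0, integral_add_measure, integral_smul_measure, integral_dirac, wd_integral hμae j
      zero_le_one, ENNReal.toReal_ofReal (h.2.1 j), one_mul, smul_eq_mul]
    · exact (integrable_dirac (by simp)).smul_measure ENNReal.ofReal_ne_top
    · exact Integrable.of_bound hG.aestronglyMeasurable C hGC
  rw [← hρ0i F C hF (Eventually.of_forall hC)]
  have hmain := weak_conv (l := 𝓝[>] 0) (fun t => wd (ν t) j t⁻¹) ρ0 ?_ ?_ ?_ ?_ F hF C hC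
  · refine hmain.congr' ?_
    filter_upwards [self_mem_nhdsWithin] with t ht
    have ht : 0 < t := Set.mem_Ioi.1 ht
    exact wd_integral (sub_ae hν ht.le) j (by positivity) F
  · filter_upwards [self_mem_nhdsWithin] with t ht
    have ht : 0 < t := Set.mem_Ioi.1 ht
    have := (hν t ht.le).1
    refine wd_fin j _ (Integrable.of_bound (Continuous.aestronglyMeasurable (by fun_prop)) 1 ?_)
    filter_upwards [sub_ae hν ht.le] with u hu
    rw [Real.norm_eq_abs, abs_of_nonneg (one_sub_nonneg j hu)]
    linarith [Real.exp_pos (-(u j))]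
  · filter_upwards [self_mem_nhdsWithin] with t ht
    exact wd_ae (sub_ae hν (Set.mem_Ioi.1 ht).le) j _
  · rw [hρ0, ae_add_measure_iff]
    refine ⟨?_, wd_ae hμae j _⟩
    refine Measure.ae_smul_measure ?_ _
    rw [ae_dirac_eq]
    simp
  · intro k
    set s : Fin n → ℝ := fun i => -(k i : ℝ) with hs
    have hs0 : ∀ i, s i ≤ 0 := fun i => by simp [hs]
    have hs1 : ∀ i, s i - (Pi.single j 1 : Fin n → ℝ) i ≤ 0 := fun i => by
      have := hs0 i
      by_cases hi : i = j
      · subst hi; simp; linarith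
      · simpa [hi] using this
    set a := psiE c₀ c₁ μ s with ha
    set b := psiE c₀ c₁ μ (fun i => s i - (Pi.single j 1 : Fin n → ℝ) i) with hb
    have e0 : ∫ u, Real.exp (∑ i, s i * u i) ∂ρ0 = a - b := by
      rw [hρ0i _ 1 (by fun_prop)]
      · simp only [exp_split]
        have : ∀ u : Fin n → ℝ, Real.exp (∑ i, s i * u i) -
          Real.exp (∑ i, (s i - (Pi.single j 1 : Fin n → ℝ) i) * u i) =
          (Real.exp (∑ i, s i * u i) - 1) -
          (Real.exp (∑ i, (s i - (Pi.single j 1 : Fin n → ℝ) i) * u i) - 1) := fun u => by ring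
        simp only [this]
        rw [integral_sub (levy_int h hs0) (levy_int h hs1), ha, hb]
        unfold psiE
        have e2 : ∑ i, c₁ i * (s i - (Pi.single j 1 : Fin n → ℝ) i) =
            ∑ i, c₁ i * s i - c₁ j := by
          simp only [mul_sub, Finset.sum_sub_distrib]
          congr 1
          rw [Finset.sum_eq_single j]
          · simp
          · intro i _ hi; simp [hi]
          · simp
        rw [e2]
        simp
        ring
      · filter_upwards [wd_ae hμae j 1] with u hu
        rw [Real.abs_exp]
        exact Real.exp_le_one_iff.2 (sum_nonpos' hs0 hu)
    rw [e0]
    refine ((exp_deriv0 a).sub (exp_deriv0 b)).congr' ?_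
    filter_upwards [self_mem_nhdsWithin] with t ht
    have ht : 0 < t := Set.mem_Ioi.1 ht
    have := (hν t ht.le).1
    have hi : ∀ s : Fin n → ℝ, (∀ i, s i ≤ 0) →
        Integrable (fun u => Real.exp (∑ i, s i * u i)) (ν t) := by
      intro s hs
      refine Integrable.of_bound (Continuous.aestronglyMeasurable (by fun_prop)) 1 ?_
      filter_upwards [sub_ae hν ht.le] with u hu
      rw [Real.norm_eq_abs, Real.abs_exp]
      exact Real.exp_le_one_iff.2 (sum_nonpos' hs hu)
    rw [wd_integral (sub_ae hν ht.le) j (by positivity)]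
    simp only [exp_split]
    rw [integral_sub (hi _ hs0) (hi _ hs1), laplace h hν ht.le hs0, laplace h hν ht.le hs1]
    ring

lemma mass_eq (h : HasLevyRep n ψ c₀ c₁ μ) (hν : IsSubordinator n ψ ν) {t : ℝ} (ht : 0 ≤ t) :
    (ν t).real Set.univ = Real.exp (t * c₀) := by
  have := laplace h hν ht (s := 0) (by simp)
  simpa [psiE] using this

end levy
section multi
set_option linter.unusedSectionVars false
variable {X : Type*} [NormedAddCommGroup X] [NormedSpace ℂ X] [CompleteSpace X]
  {n : ℕ} {T : Fin n → ℝ → X →L[ℂ] X} {M : Fin n → ℝ}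

lemma NSG.joint {S : ℝ → X →L[ℂ] X} {M : ℝ} (h : NSG S M) {Y : Type*} [TopologicalSpace Y]
    {a : Y → ℝ} {f : Y → X} (ha : Continuous a) (hf : Continuous f) :
    Continuous fun y => S (a y) (f y) := by
  rw [continuous_iff_continuousAt]
  intro y0
  rw [ContinuousAt, tendsto_iff_norm_sub_tendsto_zero]
  have h1 : Tendsto (fun y => M * ‖f y - f y0‖ + ‖S (a y) (f y0) - S (a y0) (f y0)‖) (𝓝 y0)
      (𝓝 0) := by
    have : Continuous (fun y => M * ‖f y - f y0‖ + ‖S (a y) (f y0) - S (a y0) (f y0)‖) := by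
      have := (h.2.2.1 (f y0)).comp ha
      exact (continuous_const.mul (hf.sub continuous_const).norm).add
        (this.sub continuous_const).norm
    simpa using this.tendsto y0
  refine squeeze_zero (fun _ => norm_nonneg _) (fun y => ?_) h1
  have : S (a y) (f y) - S (a y0) (f y0) =
      S (a y) (f y - f y0) + (S (a y) (f y0) - S (a y0) (f y0)) := by
    rw [map_sub]; abel
  rw [this]
  exact (norm_add_le _ _).trans (add_le_add_left (h.bound _ _) _)

def Ppart (T : Fin n → ℝ → X →L[ℂ] X) (k : ℕ) (u : Fin n → ℝ) : X →L[ℂ] X :=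
  ((List.ofFn fun j => T j (u j)).take k).prod

lemma Ppart_zero (u : Fin n → ℝ) : Ppart T 0 u = 1 := by simp [Ppart]

lemma Ppart_top (u : Fin n → ℝ) : Ppart T n u = Tprod T u := by
  unfold Ppart Tprod
  rw [List.take_of_length_le (by simp)]

lemma Ppart_succ (u : Fin n → ℝ) (j : Fin n) :
    Ppart T (j + 1) u = Ppart T j u * T j (u j) := by
  unfold Ppart
  rw [List.prod_take_succ _ _ (by simp)]
  simp

lemma Ppart_cont (hT : ∀ j, NSG (T j) (M j)) (k : ℕ) (hk : k ≤ n) :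
    ∀ f : (Fin n → ℝ) → X, Continuous f → Continuous fun u => Ppart T k u (f u) := by
  induction k with
  | zero => intro f hf; simpa [Ppart_zero] using hf
  | succ k ih =>
    intro f hf
    have := ih (by omega) (fun u => T ⟨k, hk⟩ (u ⟨k, hk⟩) (f u))
      ((hT ⟨k, hk⟩).joint (by fun_prop) hf)
    refine this.congr fun u => ?_
    have := Ppart_succ (T := T) u ⟨k, hk⟩
    simp only at this
    rw [this]; rfl

lemma Ppart_bound (hT : ∀ j, NSG (T j) (M j)) (k : ℕ) (hk : k ≤ n) :
    ∃ B : ℝ, 0 ≤ B ∧ ∀ u x, ‖Ppart T k u x‖ ≤ B * ‖x‖ := by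
  induction k with
  | zero => exact ⟨1, zero_le_one, fun u x => by simp [Ppart_zero]⟩
  | succ k ih =>
    obtain ⟨B, hB0, hB⟩ := ih (by omega)
    refine ⟨B * M ⟨k, hk⟩, mul_nonneg hB0 (hT ⟨k, hk⟩).nonneg, fun u x => ?_⟩
    have := Ppart_succ (T := T) u ⟨k, hk⟩
    simp only at this
    rw [this]
    refine (hB u (T ⟨k, hk⟩ (u ⟨k, hk⟩) x)).trans ?_
    rw [mul_assoc]
    exact mul_le_mul_of_nonneg_left ((hT ⟨k, hk⟩).bound _ _) hB0

lemma Ppart_at_zero (hT : ∀ j, NSG (T j) (M j)) (k : ℕ) (hk : k ≤ n) : Ppart T k 0 = 1 := by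
  induction k with
  | zero => exact Ppart_zero _
  | succ k ih =>
    have := Ppart_succ (T := T) 0 ⟨k, hk⟩
    simp only at this
    rw [this, ih (by omega), Pi.zero_apply, (hT _).1, mul_one]

lemma telescope (u : Fin n → ℝ) (x : X) :
    Tprod T u x - x = ∑ j : Fin n, Ppart T j u (T j (u j) x - x) := by
  have h1 : ∀ j : Fin n, Ppart T j u (T j (u j) x - x) =
      Ppart T (j + 1) u x - Ppart T j u x := by
    intro j
    rw [Ppart_succ, map_sub]; rfl
  simp only [h1]
  rw [Fin.sum_univ_eq_sum_range (fun k => Ppart T (k + 1) u x - Ppart T k u x) n,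
    Finset.sum_range_sub (fun k => Ppart T k u x), Ppart_top, Ppart_zero]
  rfl

/-- difference quotient function -/
lemma exists_quot {S : ℝ → X →L[ℂ] X} {M : ℝ} (h : NSG S M) {x y : X} (hx : InGenDomain S x y) :
    ∃ (D : ℝ → X) (C : ℝ), Continuous D ∧ D 0 = y ∧ (∀ r, ‖D r‖ ≤ C) ∧
      ∀ r, 0 ≤ r → (1 - Real.exp (-r)) • D r = S r x - x := by
  classical
  have hpos : ∀ r : ℝ, 0 < r → 0 < 1 - Real.exp (-r) := fun r hr => by
    have : Real.exp (-r) < 1 := by simpa using hr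
    linarith
  let D : ℝ → X := fun r => if r ≤ 0 then y else (1 - Real.exp (-r))⁻¹ • (S r x - x)
  have hD0 : ∀ r, r ≤ 0 → D r = y := fun r hr => if_pos hr
  have hD1 : ∀ r, 0 < r → D r = (1 - Real.exp (-r))⁻¹ • (S r x - x) := fun r hr =>
    if_neg (not_le.2 hr)
  have hlim : Tendsto D (𝓝[>] 0) (𝓝 y) := by
    have h1 : Tendsto (fun r : ℝ => (r⁻¹ * (Real.exp (r * (-1)) - 1))) (𝓝[>] 0) (𝓝 (-1)) :=
      exp_deriv0 (-1)
    have h2 := (h1.neg.inv₀ (by norm_num)).smul hx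
    simp only [neg_neg, inv_one, one_smul] at h2
    refine h2.congr' ?_
    filter_upwards [self_mem_nhdsWithin] with r hr
    have hr : 0 < r := Set.mem_Ioi.1 hr
    rw [hD1 r hr, smul_smul]
    congr 1
    have := (hpos r hr).ne'
    have e : (-(r⁻¹ * (Real.exp (r * (-1)) - 1))) = r⁻¹ * (1 - Real.exp (-r)) := by
      rw [mul_neg_one]; ring
    rw [e, mul_inv, inv_inv]
    field_simp
  have hcont : Continuous D := by
    rw [continuous_iff_continuousAt]
    intro r
    rcases lt_trichotomy r 0 with hr | hr | hr
    · have : D =ᶠ[𝓝 r] fun _ => y := by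
        filter_upwards [gt_mem_nhds hr] with s hs
        exact hD0 s hs.le
      exact continuousAt_const.congr this.symm
    · subst hr
      rw [continuousAt_iff_continuous_left'_right']
      constructor
      · rw [ContinuousWithinAt, hD0 0 le_rfl]
        refine tendsto_const_nhds.congr' ?_
        filter_upwards [self_mem_nhdsWithin] with s hs
        exact (hD0 s (Set.mem_Iio.1 hs).le).symm
      · rw [ContinuousWithinAt, hD0 0 le_rfl]
        exact hlim
    · have : D =ᶠ[𝓝 r] fun r => (1 - Real.exp (-r))⁻¹ • (S r x - x) := by
        filter_upwards [lt_mem_nhds hr] with s hs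
        exact hD1 s hs
      refine ContinuousAt.congr ?_ this.symm
      have hc := (h.2.2.1 x).continuousAt (x := r)
      have hc2 : ContinuousAt (fun r : ℝ => 1 - Real.exp (-r)) r :=
        Continuous.continuousAt (by fun_prop)
      exact (hc2.inv₀ (hpos r hr).ne').smul (hc.sub continuousAt_const)
  obtain ⟨C, hC⟩ := (isCompact_Icc (a := (0:ℝ)) (b := 1)).exists_bound_of_continuousOn
    hcont.continuousOn
  refine ⟨D, max C ((1 - Real.exp (-1))⁻¹ * (M * ‖x‖ + ‖x‖)), hcont, hD0 0 le_rfl, ?_, ?_⟩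
  · intro r
    rcases le_total r 1 with hr | hr
    · refine le_max_of_le_left ?_
      rcases le_total r 0 with hr0 | hr0
      · rw [hD0 r hr0, ← hD0 0 le_rfl]
        exact hC 0 (by simp)
      · exact hC r ⟨hr0, hr⟩
    · refine le_max_of_le_right ?_
      have hp := hpos 1 one_pos
      have hr' := hpos r (by linarith)
      rw [hD1 r (by linarith), norm_smul, norm_inv, Real.norm_eq_abs, abs_of_pos hr']
      refine mul_le_mul ?_ ?_ (norm_nonneg _) (by positivity)
      · apply inv_anti₀ hp
        have := Real.exp_le_exp.2 (neg_le_neg hr)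
        linarith
      · exact (norm_sub_le _ _).trans (by linarith [h.bound r x])
  · intro r hr
    rcases hr.eq_or_lt with rfl | hr
    · simp [h.1]
    · rw [hD1 r hr, smul_inv_smul₀ (hpos r hr).ne']

lemma weak_gen (hT : ∀ j, NSG (T j) (M j))
    {ψ : (Fin n → ℝ) → ℝ} {c₀ : ℝ} {c₁ : Fin n → ℝ} {μ : Measure (Fin n → ℝ)}
    {ν : ℝ → Measure (Fin n → ℝ)}
    (hrep : HasLevyRep n ψ c₀ c₁ μ) (hν : IsSubordinator n ψ ν)
    {x : X} {y : Fin n → X} (hx : ∀ j, InGenDomain (T j) x (y j)) (φ : X →L[ℝ] ℝ) :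
    Tendsto (fun t : ℝ => φ (t⁻¹ • ((∫ u, Tprod T u x ∂(ν t)) - x))) (𝓝[>] 0)
      (𝓝 (φ (c₀ • x + (∑ j, c₁ j • y j) + ∫ u, (Tprod T u x - x) ∂μ))) := by
  choose D C hDc hD0 hDC hD using fun j => exists_quot (hT j) (hx j)
  choose B hB0 hB using fun j : Fin n => Ppart_bound hT j j.2.le
  let G : Fin n → (Fin n → ℝ) → X := fun j u => Ppart T j u (D j (u j))
  have hGc : ∀ j, Continuous (G j) := fun j =>
    Ppart_cont hT j j.2.le _ ((hDc j).comp (continuous_apply j))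
  have hGb : ∀ j u, ‖G j u‖ ≤ B j * C j := fun j u =>
    (hB j u _).trans (mul_le_mul_of_nonneg_left (hDC j _) (hB0 j))
  have hG0 : ∀ j, G j 0 = y j := fun j => by
    simp only [G, Ppart_at_zero hT j j.2.le, Pi.zero_apply, hD0]; rfl
  have hsum : ∀ u : Fin n → ℝ, (∀ j, 0 ≤ u j) →
      Tprod T u x - x = ∑ j, (1 - Real.exp (-(u j))) • G j u := by
    intro u hu
    rw [telescope]
    refine Finset.sum_congr rfl fun j _ => ?_
    rw [← hD j (u j) (hu j)]
    exact ((Ppart T j u).restrictScalars ℝ).map_smul _ _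
  have hterm : ∀ (κ : Measure (Fin n → ℝ)) (j : Fin n),
      Integrable (fun u => 1 - Real.exp (-(u j))) κ →
      Integrable (fun u => (1 - Real.exp (-(u j))) • G j u) κ := by
    intro κ j hκ
    refine (hκ.norm.mul_const (B j * C j)).mono'
      (Continuous.aestronglyMeasurable ?_) (Eventually.of_forall fun u => ?_)
    · have := hGc j
      fun_prop
    · rw [norm_smul]
      exact mul_le_mul_of_nonneg_left (hGb j u) (norm_nonneg _)
  have hφ : ∀ κ : Measure (Fin n → ℝ), (∀ᵐ u ∂κ, ∀ j, 0 ≤ u j) →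
      (∀ j : Fin n, Integrable (fun u => 1 - Real.exp (-(u j))) κ) →
      Integrable (fun u => Tprod T u x - x) κ ∧
      φ (∫ u, (Tprod T u x - x) ∂κ) = ∑ j, ∫ u, (1 - Real.exp (-(u j))) * φ (G j u) ∂κ := by
    intro κ hκ hi
    have e : (fun u => Tprod T u x - x) =ᵐ[κ] fun u => ∑ j, (1 - Real.exp (-(u j))) • G j u :=
      hκ.mono hsum
    have hI : Integrable (fun u => ∑ j, (1 - Real.exp (-(u j))) • G j u) κ :=
      integrable_finsetSum _ fun j _ => hterm κ j (hi j)
    refine ⟨hI.congr e.symm, ?_⟩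
    rw [integral_congr_ae e, integral_finsetSum _ fun j _ => hterm κ j (hi j), map_sum]
    refine Finset.sum_congr rfl fun j _ => ?_
    rw [← φ.integral_comp_comm (hterm κ j (hi j))]
    simp
  have hconv : ∀ j, Tendsto (fun t => t⁻¹ * ∫ u, (1 - Real.exp (-(u j))) * φ (G j u) ∂(ν t))
      (𝓝[>] 0) (𝓝 (c₁ j * φ (G j 0) + ∫ u, (1 - Real.exp (-(u j))) * φ (G j u) ∂μ)) := by
    intro j
    refine rho_conv hrep hν j (fun u => φ (G j u)) (φ.continuous.comp (hGc j))
      (‖φ‖ * (B j * C j)) (fun u => ?_)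
    exact (φ.le_opNorm _).trans (mul_le_mul_of_nonneg_left (hGb j u) (norm_nonneg _))
  have htot := ((exp_deriv0 c₀).mul_const (φ x)).add (tendsto_finsetSum Finset.univ
    fun j _ => hconv j)
  have elim : φ (c₀ • x + (∑ j, c₁ j • y j) + ∫ u, (Tprod T u x - x) ∂μ) = c₀ * φ x +
      ∑ j, (c₁ j * φ (G j 0) + ∫ u, (1 - Real.exp (-(u j))) * φ (G j u) ∂μ) := by
    rw [map_add, map_add, (hφ μ (levy_ae hrep) (levy_int_j hrep)).2, map_sum,
      Finset.sum_add_distrib]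
    simp only [map_smul, hG0, smul_eq_mul]
    ring
  rw [elim]
  refine htot.congr' ?_
  filter_upwards [self_mem_nhdsWithin] with t ht
  have ht : 0 < t := Set.mem_Ioi.1 ht
  have := (hν t ht.le).1
  have hi : ∀ j : Fin n, Integrable (fun u => 1 - Real.exp (-(u j))) (ν t) := by
    intro j
    refine Integrable.of_bound (Continuous.aestronglyMeasurable (by fun_prop)) 1 ?_
    filter_upwards [sub_ae hν ht.le] with u hu
    rw [Real.norm_eq_abs, abs_of_nonneg (one_sub_nonneg j hu)]
    linarith [Real.exp_pos (-(u j))]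
  obtain ⟨h1, h2⟩ := hφ (ν t) (sub_ae hν ht.le) hi
  have h3 : (∫ u, Tprod T u x ∂(ν t)) = (∫ u, (Tprod T u x - x) ∂(ν t)) +
      Real.exp (t * c₀) • x := by
    rw [← mass_eq hrep hν ht.le, ← integral_const, ← integral_add h1 (integrable_const _)]
    simp
  rw [h3, map_smul, map_sub, map_add, h2, map_smul, smul_eq_mul, smul_eq_mul, ← Finset.mul_sum]
  ring

lemma exists_smoothing (hT : ∀ j, NSG (T j) (M j))
    (hcomm : ∀ i j s t, Commute (T i s) (T j t)) (k : ℕ) (hk : k ≤ n) :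
    ∃ (V : ℝ → X →L[ℂ] X) (B : ℝ), (∀ ε, 0 < ε → ‖V ε‖ ≤ B) ∧
      (∀ L : X →L[ℂ] X, (∀ i t, 0 ≤ t → Commute L (T i t)) → ∀ ε, 0 < ε → Commute L (V ε)) ∧
      (∀ x, Tendsto (fun ε => V ε x) (𝓝[>] 0) (𝓝 x)) ∧
      ∀ ε, 0 < ε → ∀ x, ∀ i : Fin n, (i : ℕ) < k → ∃ y, InGenDomain (T i) (V ε x) y := by
  induction k with
  | zero =>
    refine ⟨fun _ => 1, ‖(1 : X →L[ℂ] X)‖, fun _ _ => le_rfl, fun L _ _ _ => Commute.one_right L,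
      fun x => ?_, fun ε hε x i hi => by omega⟩
    simp
  | succ k ih =>
    obtain ⟨V, B, hVB, hVc, hVt, hVd⟩ := ih (by omega)
    set j : Fin n := ⟨k, hk⟩
    obtain ⟨J, hJ, hJb⟩ := (hT j).exists_int
    have hB0 : 0 ≤ B := (norm_nonneg _).trans (hVB 1 one_pos)
    have hW : ∀ (ε : ℝ) x, ((ε⁻¹ : ℝ) • J ε) x = ε⁻¹ • ∫ r in (0:ℝ)..ε, T j r x := fun ε x => by
      rw [← hJ]; rfl
    have hWc : ∀ L : X →L[ℂ] X, (∀ i t, 0 ≤ t → Commute L (T i t)) → ∀ ε, 0 < ε →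
        Commute L ((ε⁻¹ : ℝ) • J ε) := by
      intro L hL ε hε
      ext x
      simp only [mul_apply_eq_comp, hW]
      have e1 : L (ε⁻¹ • ∫ r in (0:ℝ)..ε, T j r x) = ε⁻¹ • L (∫ r in (0:ℝ)..ε, T j r x) :=
        (L.restrictScalars ℝ).map_smul _ _
      rw [e1, ← L.intervalIntegral_comp_comm (((hT j).2.2.1 x).intervalIntegrable _ _)]
      congr 1
      apply intervalIntegral.integral_congr
      intro r hr
      rw [Set.uIcc_of_le hε.le] at hr
      have := congrArg (fun L : X →L[ℂ] X => L x) (hL j r hr.1).eq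
      simpa using this
    refine ⟨fun ε => V ε * ((ε⁻¹ : ℝ) • J ε), B * M j, ?_, ?_, ?_, ?_⟩
    · intro ε hε
      refine (norm_mul_le _ _).trans (mul_le_mul (hVB ε hε) ?_ (norm_nonneg _) hB0)
      rw [norm_smul, norm_inv, Real.norm_eq_abs]
      have := hJb ε
      have hε' : 0 < |ε| := abs_pos.2 hε.ne'
      rw [inv_mul_le_iff₀ hε', mul_comm]
      exact this
    · intro L hL ε hε
      exact (hVc L hL ε hε).mul_right (hWc L hL ε hε)
    · intro x
      rw [tendsto_iff_norm_sub_tendsto_zero]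
      have h1 := tendsto_iff_norm_sub_tendsto_zero.1 ((hT j).avg_tendsto x)
      have h2 := tendsto_iff_norm_sub_tendsto_zero.1 (hVt x)
      have h3 := (h1.const_mul B).add h2
      simp only [mul_zero, add_zero] at h3
      refine squeeze_zero' (Eventually.of_forall fun _ => norm_nonneg _) ?_ h3
      filter_upwards [self_mem_nhdsWithin] with ε hε
      have e : (V ε * ((ε⁻¹ : ℝ) • J ε)) x - x =
          V ε ((ε⁻¹ • ∫ r in (0:ℝ)..ε, T j r x) - x) + (V ε x - x) := by
        rw [mul_apply_eq_comp, hW, map_sub]; abel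
      rw [e]
      refine (norm_add_le _ _).trans (add_le_add_left ?_ _)
      exact ((V ε).le_opNorm _).trans
        (mul_le_mul_of_nonneg_right (hVB ε (Set.mem_Ioi.1 hε)) (norm_nonneg _))
    · intro ε hε x i hi
      rcases Nat.lt_succ_iff_lt_or_eq.1 hi with hi | hi
      · exact hVd ε hε _ i hi
      · have hij : i = j := Fin.ext hi
        rw [hij]
        have h1 := (hT j).avg_mem x hε.le
        have h2 := inGen_comm h1 ((ε⁻¹ : ℝ) • (1 : X →L[ℂ] X))
          (fun t _ => by ext z; simp)
        have h3 := inGen_comm h2 (V ε)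
          (fun t ht => (hVc (T j t) (fun i' t' _ => hcomm _ _ _ _) ε hε).symm)
        have e : (V ε * ((ε⁻¹ : ℝ) • J ε)) x =
            V ε (((ε⁻¹ : ℝ) • (1 : X →L[ℂ] X)) (∫ r in (0:ℝ)..ε, T j r x)) := by
          rw [mul_apply_eq_comp, hW]
          rfl
        rw [e]
        exact ⟨_, h3⟩

lemma core_thm (hT : ∀ j, NSG (T j) (M j))
    (hcomm : ∀ i j s t, Commute (T i s) (T j t))
    {ψ : (Fin n → ℝ) → ℝ} {c₀ : ℝ} {c₁ : Fin n → ℝ} {μ : Measure (Fin n → ℝ)}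
    {ν : ℝ → Measure (Fin n → ℝ)}
    (hrep : HasLevyRep n ψ c₀ c₁ μ) (hν : IsSubordinator n ψ ν)
    (g : ℝ → X →L[ℂ] X) (hgsem : IsC0Semigroup g)
    (hg : ∀ t, 0 ≤ t → ∀ x : X, g t x = ∫ u, Tprod T u x ∂(ν t)) :
    closure {p : X × X | ∃ y : Fin n → X, (∀ j, InGenDomain (T j) p.1 (y j)) ∧
        p.2 = c₀ • p.1 + (∑ j, c₁ j • y j) + ∫ u, (Tprod T u p.1 - p.1) ∂μ}
      = {p : X × X | InGenDomain g p.1 p.2} := by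
  obtain ⟨B, hB0, hB⟩ := Ppart_bound hT n le_rfl
  simp only [Ppart_top] at hB
  have hcontT : ∀ x, Continuous fun u => Tprod T u x := by
    intro x
    have := Ppart_cont hT n le_rfl (fun _ => x) continuous_const
    simpa only [Ppart_top] using this
  have hgb : ∀ t, 0 ≤ t → ‖g t‖ ≤ B := by
    intro t ht
    have := (hν t ht).1
    refine ContinuousLinearMap.opNorm_le_bound _ hB0 fun x => ?_
    rw [hg t ht]
    refine (norm_integral_le_of_norm_le_const (Eventually.of_forall fun u => hB u x)).trans ?_
    rw [mass_eq hrep hν ht]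
    have h1 : Real.exp (t * c₀) ≤ 1 :=
      Real.exp_le_one_iff.2 (mul_nonpos_of_nonneg_of_nonpos ht hrep.1)
    exact mul_le_of_le_one_right (mul_nonneg hB0 (norm_nonneg _)) h1
  have hG := NSG.of_c0 hgsem hgb
  have hclosed : IsClosed {p : X × X | InGenDomain g p.1 p.2} := by
    have := hG.closed
    simpa only [inGen_max] using this
  have hgen : ∀ (x : X) (y : Fin n → X), (∀ j, InGenDomain (T j) x (y j)) →
      InGenDomain g x (c₀ • x + (∑ j, c₁ j • y j) + ∫ u, (Tprod T u x - x) ∂μ) := by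
    intro x y hxy
    rw [← inGen_max]
    refine hG.of_int fun t ht => hG.weak (fun φ => ?_) ht
    refine (weak_gen hT hrep hν hxy φ).congr' ?_
    filter_upwards [self_mem_nhdsWithin] with t ht
    have ht : 0 < t := Set.mem_Ioi.1 ht
    rw [max_eq_left ht.le, hg t ht.le]
  have hgc : ∀ t, 0 ≤ t → ∀ i s, 0 ≤ s → Commute (g t) (T i s) := by
    intro t ht i s _
    have := (hν t ht).1
    ext x
    simp only [mul_apply_eq_comp, hg t ht]
    rw [← (T i s).integral_comp_comm (integrable_of_bdd_cont (hcontT x) (fun u => hB u x))]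
    congr 1
    funext u
    have hc : Commute (T i s) (Tprod T u) := by
      unfold Tprod
      refine Commute.list_prod_right _ _ fun b hb => ?_
      rw [List.mem_ofFn] at hb
      obtain ⟨j, rfl⟩ := hb
      exact hcomm _ _ _ _
    have := congrArg (fun L : X →L[ℂ] X => L x) hc.eq
    simpa using this.symm
  apply Set.Subset.antisymm
  · refine closure_minimal ?_ hclosed
    rintro ⟨x, z⟩ ⟨y, hy, hz⟩
    simp only at hz hy
    subst hz
    exact hgen x y hy
  · rintro ⟨x, z⟩ hxz
    have hxz : InGenDomain g x z := hxz
    obtain ⟨V, B', -, hVc, hVt, hVd⟩ := exists_smoothing hT hcomm n le_rfl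
    have hlim : Tendsto (fun ε => (V ε x, V ε z)) (𝓝[>] 0) (𝓝 (x, z)) :=
      (hVt x).prodMk_nhds (hVt z)
    refine mem_closure_of_tendsto hlim ?_
    filter_upwards [self_mem_nhdsWithin] with ε hε
    have hε : 0 < ε := Set.mem_Ioi.1 hε
    choose y hy using fun i : Fin n => hVd ε hε x i i.2
    refine ⟨y, hy, ?_⟩
    have h1 := hgen _ _ hy
    have h2 := inGen_comm hxz (V ε)
      (fun t ht => (hVc (g t) (fun i s hs => hgc t ht i s hs) ε hε).symm)
    exact tendsto_nhds_unique h2 h1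

end multi

/-- For `ψ ∈ 𝒯ₙ` and pairwise commuting generators `A = (A₁,…,Aₙ)` of
uniformly bounded `C₀`-semigroups, the operator `ψ(A)` defined on `D(A) = ∩ⱼ D(Aⱼ)` by
`ψ(A)x = c₀x + c₁·Ax + ∫ (T(u) - I)x dμ(u)` is closable, and its closure is exactly the
generator of the `C₀`-semigroup `g(A)`, `g_t(A)x = ∫ T(u)x dν_t(u)`: the closure of its
graph is the graph of the generator of `g(A)`. -/
theorem closure_bernstein_op_eq_generator_of_subordinated
    {X : Type*} [NormedAddCommGroup X] [NormedSpace ℂ X] [CompleteSpace X]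
    {n : ℕ} (T : Fin n → ℝ → X →L[ℂ] X) (M : Fin n → ℝ)
    (hT : ∀ j, IsC0Semigroup (T j)) (hM : ∀ j t, 0 ≤ t → ‖T j t‖ ≤ M j)
    (hcomm : ∀ i j s t, 0 ≤ s → 0 ≤ t → T i s ∘L T j t = T j t ∘L T i s)
    (ψ : (Fin n → ℝ) → ℝ) (c₀ : ℝ) (c₁ : Fin n → ℝ) (μ : MeasureTheory.Measure (Fin n → ℝ))
    (hψ : MemTn n ψ) (hrep : HasLevyRep n ψ c₀ c₁ μ)
    (ν : ℝ → MeasureTheory.Measure (Fin n → ℝ)) (hν : IsSubordinator n ψ ν)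
    (g : ℝ → X →L[ℂ] X) (hgsem : IsC0Semigroup g)
    (hg : ∀ t, 0 ≤ t → ∀ x : X, g t x = ∫ u, Tprod T u x ∂(ν t)) :
    closure {p : X × X | ∃ y : Fin n → X, (∀ j, InGenDomain (T j) p.1 (y j)) ∧
        p.2 = c₀ • p.1 + (∑ j, c₁ j • y j) + ∫ u, (Tprod T u p.1 - p.1) ∂μ}
      = {p : X × X | InGenDomain g p.1 p.2} := by
  have hS : ∀ j, NSG (fun t => T j (max t 0)) (M j) := fun j => NSG.of_c0 (hT j) (hM j)
  have hTp : ∀ u : Fin n → ℝ, (∀ j, 0 ≤ u j) →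
      Tprod (fun j t => T j (max t 0)) u = Tprod T u := by
    intro u hu
    unfold Tprod
    simp only [max_eq_left (hu _)]
  have key := core_thm (T := fun j t => T j (max t 0)) hS
    (fun i j s t => hcomm i j _ _ (le_max_right _ _) (le_max_right _ _)) hrep hν g hgsem
    (fun t ht x => by
      rw [hg t ht]
      apply integral_congr_ae
      filter_upwards [sub_ae hν ht] with u hu
      rw [hTp u hu])
  have hint : ∀ x : X, ∫ u, (Tprod (fun j t => T j (max t 0)) u x - x) ∂μ =
      ∫ u, (Tprod T u x - x) ∂μ := by
    intro x
    apply integral_congr_ae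
    filter_upwards [levy_ae hrep] with u hu
    rw [hTp u hu]
  simp only [hint, inGen_max] at key
  exact key
end

section
/- Let ψ ∈ T_n and let A = (A₁,…,Aₙ) be pairwise commuting generators of uniformly bounded C₀-semigroups on a complex Banach space X. Then ψ maps the joint point spectrum of A into the point spectrum of ψ(A): σ_p(ψ(A)) ⊇ ψ(σ_p(A)). More precisely, if x ∈ D(A), x ≠ 0, and Aⱼx = λⱼx for all j, then x ∈ D(ψ(A)) and ψ(A)x = ψ(λ)x. -/
open MeasureTheory Filter Topology

theorem aux_exp_neg_le {r y : ℝ} (hr : 0 ≤ r) (hr1 : r ≤ 1) (hry : r ≤ y) :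
    r / 2 ≤ 1 - Real.exp (-y) := by
  have h1 : Real.exp (-y) ≤ Real.exp (-r) := Real.exp_le_exp.2 (by linarith)
  have h2 : r + 1 ≤ Real.exp r := Real.add_one_le_exp r
  have h3 : Real.exp (-r) * Real.exp r = 1 := by rw [← Real.exp_add]; simp
  have h4 : 0 < Real.exp (-r) := Real.exp_pos _
  have h5 : Real.exp (-r) * (r + 1) ≤ 1 := by nlinarith
  have h6 : Real.exp (-r) ≤ 1 - r / 2 := by
    by_contra hcon
    push Not at hcon
    nlinarith
  linarith

theorem aux_norm_exp_sub_one {w : ℂ} {y : ℝ} (hw : w.re ≤ 0) (hwy : ‖w‖ ≤ y) :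
    ‖Complex.exp w - 1‖ ≤ 4 * (1 - Real.exp (-y)) := by
  by_cases h : ‖w‖ ≤ 1
  · have := Complex.norm_exp_sub_one_le h
    have h2 := aux_exp_neg_le (norm_nonneg w) h hwy
    linarith
  · push Not at h
    have h2 := aux_exp_neg_le (r := 1) (y := y) zero_le_one le_rfl (by linarith)
    have h3 : ‖Complex.exp w - 1‖ ≤ ‖Complex.exp w‖ + ‖(1 : ℂ)‖ := norm_sub_le _ _
    rw [Complex.norm_exp, norm_one] at h3
    have : Real.exp w.re ≤ 1 := Real.exp_le_one_iff.2 hw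
    linarith

theorem aux_re_dot {n : ℕ} (l : Fin n → ℂ) (u : Fin n → ℝ) :
    (∑ j, l j * (u j : ℂ)).re = ∑ j, (l j).re * u j := by
  simp [Complex.re_sum]

theorem aux_norm_dot {n : ℕ} (l : Fin n → ℂ) (u : Fin n → ℝ) (hu : ∀ j, 0 ≤ u j) {B : ℝ}
    (hB : ∀ j, ‖l j‖ ≤ B) : ‖∑ j, l j * (u j : ℂ)‖ ≤ ∑ j, B * u j := by
  refine (norm_sum_le _ _).trans (Finset.sum_le_sum fun j _ => ?_)
  rw [norm_mul, Complex.norm_real, Real.norm_of_nonneg (hu j)]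
  exact mul_le_mul_of_nonneg_right (hB j) (hu j)

/-- the class of measures for which everything works -/
def AuxGood {n : ℕ} (m : Measure (Fin n → ℝ)) : Prop :=
  (∀ᵐ u ∂m, ∀ j, 0 ≤ u j) ∧
    ∀ s ∈ negOrthant n, Integrable (fun u => Real.exp (∑ j, s j * u j) - 1) m

theorem AuxGood.int_bound {n : ℕ} {m : Measure (Fin n → ℝ)} (hm : AuxGood m) {B : ℝ}
    (hB : 0 < B) (C : ℝ) : Integrable (fun u => C * (1 - Real.exp (-∑ j, B * u j))) m := by
  have := (hm.2 (fun _ => -B) (fun j => by simpa using hB)).neg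
  refine (this.congr (Eventually.of_forall fun u => ?_)).const_mul C
  simp [Finset.sum_neg_distrib]

theorem aux_meas {n : ℕ} (m : Measure (Fin n → ℝ)) (l : Fin n → ℂ) :
    AEStronglyMeasurable (fun u : Fin n → ℝ => Complex.exp (∑ j, l j * (u j : ℂ)) - 1) m := by
  apply Continuous.aestronglyMeasurable
  fun_prop

theorem aux_ptwise {n : ℕ} (l : Fin n → ℂ) (hl : ∀ j, (l j).re ≤ 0) {B : ℝ}
    (hB : ∀ j, ‖l j‖ ≤ B) (u : Fin n → ℝ) (hu : ∀ j, 0 ≤ u j) :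
    ‖Complex.exp (∑ j, l j * (u j : ℂ)) - 1‖ ≤ 4 * (1 - Real.exp (-∑ j, B * u j)) := by
  refine aux_norm_exp_sub_one ?_ (aux_norm_dot l u hu hB)
  rw [aux_re_dot]
  exact Finset.sum_nonpos fun j _ => mul_nonpos_of_nonpos_of_nonneg (hl j) (hu j)

theorem aux_exists_B {n : ℕ} (l : Fin n → ℂ) : ∃ B : ℝ, 0 < B ∧ ∀ j, ‖l j‖ ≤ B :=
  ⟨‖l‖ + 1, by positivity, fun j => (norm_le_pi_norm l j).trans (by linarith)⟩

theorem AuxGood.integrable {n : ℕ} {m : Measure (Fin n → ℝ)} (hm : AuxGood m)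
    (l : Fin n → ℂ) (hl : ∀ j, (l j).re ≤ 0) :
    Integrable (fun u : Fin n → ℝ => Complex.exp (∑ j, l j * (u j : ℂ)) - 1) m := by
  obtain ⟨B, hB0, hB⟩ := aux_exists_B l
  refine (hm.int_bound hB0 4).mono' (aux_meas m l) ?_
  filter_upwards [hm.1] with u hu using aux_ptwise l hl hB u hu

theorem AuxGood.tendsto {n : ℕ} {m : Measure (Fin n → ℝ)} (hm : AuxGood m)
    (l : Fin n → ℂ) (hl : ∀ j, (l j).re ≤ 0) :
    Tendsto (fun e : ℝ => ∫ u, (Complex.exp (∑ j, (l j - (e : ℂ)) * (u j : ℂ)) - 1) ∂m)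
      (𝓝[>] 0) (𝓝 (∫ u, (Complex.exp (∑ j, l j * (u j : ℂ)) - 1) ∂m)) := by
  obtain ⟨B, hB0, hB⟩ := aux_exists_B l
  refine tendsto_integral_filter_of_dominated_convergence
    (fun u => 4 * (1 - Real.exp (-∑ j, (B + 1) * u j))) ?_ ?_
    (hm.int_bound (by linarith) 4) ?_
  · exact Eventually.of_forall fun e => aux_meas m _
  · have h1 : ∀ᶠ e : ℝ in 𝓝[>] 0, e < 1 := nhdsWithin_le_nhds (eventually_lt_nhds one_pos)
    filter_upwards [h1, self_mem_nhdsWithin] with e he1 he0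
    have he0 : 0 < e := he0
    filter_upwards [hm.1] with u hu
    refine aux_ptwise (fun j => l j - (e : ℂ)) (fun j => ?_) (fun j => ?_) u hu
    · have := hl j
      simp; linarith
    · refine (norm_sub_le _ _).trans ?_
      rw [Complex.norm_real, Real.norm_of_nonneg he0.le]
      have := hB j
      linarith
  · refine Eventually.of_forall fun u => ?_
    have hc : Continuous fun e : ℝ => Complex.exp (∑ j, (l j - (e : ℂ)) * (u j : ℂ)) - 1 := by
      fun_prop
    have := (hc.tendsto 0).mono_left (nhdsWithin_le_nhds (s := Set.Ioi 0))
    simpa using this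

theorem aux_exists_delta {n : ℕ} (a : Fin n → ℝ) (ha : ∀ j, a j < 0) :
    ∃ δ : ℝ, 0 < δ ∧ ∀ j, a j < -δ := by
  have h : ∀ᶠ δ : ℝ in 𝓝[>] 0, ∀ j, a j < -δ := by
    refine eventually_all.2 fun j => nhdsWithin_le_nhds ?_
    filter_upwards [eventually_lt_nhds (show (0 : ℝ) < -a j by linarith [ha j])] with δ hδ
    linarith
  obtain ⟨δ, h1, h2⟩ := (h.and self_mem_nhdsWithin).exists
  exact ⟨δ, h2, h1⟩

theorem AuxGood.differentiableAt {n : ℕ} {m : Measure (Fin n → ℝ)} (hm : AuxGood m)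
    (a b : Fin n → ℝ) (z : ℂ) (hz : ∀ j, a j + z.re * b j < 0) :
    DifferentiableAt ℂ
      (fun z : ℂ => ∫ u, (Complex.exp (∑ j, ((a j : ℂ) + z * b j) * (u j : ℂ)) - 1) ∂m) z := by
  obtain ⟨δ, hδ0, hδ⟩ := aux_exists_delta _ hz
  obtain ⟨B, hB0, hB⟩ := aux_exists_B (fun j => (b j : ℂ))
  have hs : {w : ℂ | ∀ j, a j + w.re * b j < -δ} ∈ 𝓝 z := by
    have : ∀ᶠ w : ℂ in 𝓝 z, ∀ j, a j + w.re * b j < -δ := by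
      refine eventually_all.2 fun j => ?_
      have hc : Continuous fun w : ℂ => a j + w.re * b j := by fun_prop
      exact (hc.tendsto z).eventually_lt_const (hδ j)
    exact this
  refine (hasDerivAt_integral_of_dominated_loc_of_deriv_le (μ := m) (𝕜 := ℂ)
    (F' := fun z u => Complex.exp (∑ j, ((a j : ℂ) + z * b j) * (u j : ℂ)) *
      (∑ j, (b j : ℂ) * (u j : ℂ)))
    (bound := fun u => (B / δ) * (1 - Real.exp (-∑ j, δ * u j))) hs ?_ ?_ ?_ ?_
    (hm.int_bound hδ0 _) ?_).2.differentiableAt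
  · exact Eventually.of_forall fun w => aux_meas m _
  · exact hm.integrable _ (fun j => by simpa using (hz j).le)
  · apply Continuous.aestronglyMeasurable
    fun_prop
  · filter_upwards [hm.1] with u hu w hw
    have hw : ∀ j, a j + w.re * b j < -δ := hw
    have h1 := aux_norm_dot (fun j => (b j : ℂ)) u hu hB
    set S := ∑ j, u j with hS
    have hS0 : 0 ≤ S := Finset.sum_nonneg fun j _ => hu j
    rw [← Finset.mul_sum] at h1 ⊢
    rw [norm_mul, Complex.norm_exp, aux_re_dot]
    have h2 : ∑ j, ((a j : ℂ) + w * b j).re * u j ≤ -(δ * S) := by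
      rw [hS, Finset.mul_sum, ← Finset.sum_neg_distrib]
      refine Finset.sum_le_sum fun j _ => ?_
      have := mul_le_mul_of_nonneg_right (hw j).le (hu j)
      simpa using this
    have h3 := Real.exp_le_exp.2 h2
    have h4 : (δ * S) + 1 ≤ Real.exp (δ * S) := Real.add_one_le_exp _
    have h5 : Real.exp (-(δ * S)) * Real.exp (δ * S) = 1 := by rw [← Real.exp_add]; simp
    have h6 : 0 < Real.exp (-(δ * S)) := Real.exp_pos _
    have h7 : Real.exp (-(δ * S)) * (δ * S) ≤ 1 - Real.exp (-(δ * S)) := by nlinarith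
    calc _ ≤ Real.exp (-(δ * S)) * (B * S) := by gcongr
      _ = (B / δ) * (Real.exp (-(δ * S)) * (δ * S)) := by field_simp
      _ ≤ _ := by gcongr
  · refine Eventually.of_forall fun u w _ => ?_
    refine (HasDerivAt.cexp ?_).sub_const 1
    refine HasDerivAt.fun_sum fun j _ => ?_
    simpa using (((hasDerivAt_id w).mul_const (b j : ℂ)).const_add (a j : ℂ)).mul_const (u j : ℂ)

theorem aux_real_integral {n : ℕ} (m : Measure (Fin n → ℝ)) (s : Fin n → ℝ) :
    ∫ u, (Complex.exp (∑ j, (s j : ℂ) * (u j : ℂ)) - 1) ∂m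
      = ((∫ u, (Real.exp (∑ j, s j * u j) - 1) ∂m : ℝ) : ℂ) := by
  rw [← integral_complex_ofReal]
  congr 1
  ext u
  push_cast
  rfl

theorem aux_nu_good {n : ℕ} {m : Measure (Fin n → ℝ)} [IsFiniteMeasure m]
    (h0 : m {u | ¬ ∀ j, 0 ≤ u j} = 0) : AuxGood m := by
  have h : ∀ᵐ u ∂m, ∀ j, 0 ≤ u j := h0
  refine ⟨h, fun s hs => ?_⟩
  refine Integrable.mono' (integrable_const (1 : ℝ)) ?_ ?_
  · apply Continuous.aestronglyMeasurable
    fun_prop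
  · filter_upwards [h] with u hu
    have h1 : ∑ j, s j * u j ≤ 0 :=
      Finset.sum_nonpos fun j _ => mul_nonpos_of_nonpos_of_nonneg (le_of_lt (hs j)) (hu j)
    have h2 := Real.exp_le_one_iff.2 h1
    have h3 := Real.exp_pos (∑ j, s j * u j)
    rw [Real.norm_eq_abs, abs_le]
    constructor <;> linarith

theorem aux_key {n : ℕ} {ψ : (Fin n → ℝ) → ℝ} {c₀ : ℝ} {c₁ : Fin n → ℝ}
    {μ m : Measure (Fin n → ℝ)} (hrep : HasLevyRep n ψ c₀ c₁ μ) [IsFiniteMeasure m]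
    (h0 : m {u | ¬ ∀ j, 0 ≤ u j} = 0) (t : ℝ)
    (hm : ∀ s ∈ negOrthant n, ∫ u, Real.exp (∑ j, s j * u j) ∂m = Real.exp (t * ψ s))
    (l : Fin n → ℂ) (hl : ∀ j, (l j).re ≤ 0) :
    ∫ u, Complex.exp (∑ j, l j * (u j : ℂ)) ∂m = Complex.exp (t * psiC n c₀ c₁ μ l) := by
  have gm : AuxGood m := aux_nu_good h0
  obtain ⟨-, -, hμ0, hμi, hψ⟩ := hrep
  have gμ : AuxGood μ := by
    refine ⟨?_, hμi⟩
    have : ∀ᵐ u ∂μ, (∀ j, 0 ≤ u j) ∧ u ≠ 0 := hμ0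
    exact this.mono fun u hu => hu.1
  set V : ℂ := ((m.real Set.univ : ℝ) : ℂ) with hV
  have hsplit : ∀ k : Fin n → ℂ, (∀ j, (k j).re ≤ 0) →
      ∫ u, Complex.exp (∑ j, k j * (u j : ℂ)) ∂m
        = ∫ u, (Complex.exp (∑ j, k j * (u j : ℂ)) - 1) ∂m + V := by
    intro k hk
    have h1 := integral_add (gm.integrable k hk) (integrable_const (μ := m) (1 : ℂ))
    simp only [sub_add_cancel, integral_const] at h1
    rw [h1, hV]
    simp
  -- real points
  have hreal : ∀ s ∈ negOrthant n,
      ∫ u, (Complex.exp (∑ j, (s j : ℂ) * (u j : ℂ)) - 1) ∂m + V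
        = Complex.exp (t * psiC n c₀ c₁ μ (fun j => (s j : ℂ))) := by
    intro s hs
    rw [← hsplit (fun j => (s j : ℂ)) (fun j => by simpa using le_of_lt (hs j))]
    have h1 : ∫ u, Complex.exp (∑ j, (s j : ℂ) * (u j : ℂ)) ∂m
        = ((∫ u, Real.exp (∑ j, s j * u j) ∂m : ℝ) : ℂ) := by
      rw [← integral_complex_ofReal]
      congr 1
      ext u
      push_cast
      rfl
    rw [h1, hm s hs, psiC, aux_real_integral, hψ s hs]
    push_cast
    rfl
  -- interior points
  have hint : ∀ k : Fin n → ℂ, (∀ j, (k j).re < 0) →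
      ∫ u, (Complex.exp (∑ j, k j * (u j : ℂ)) - 1) ∂m + V
        = Complex.exp (t * psiC n c₀ c₁ μ k) := by
    intro k hk
    set a : Fin n → ℝ := fun j => (k j).re with ha
    set b : Fin n → ℝ := fun j => (k j).im with hb
    let U : Set ℂ := {z | ∀ j, a j + z.re * b j < 0}
    have hUo : IsOpen U := by
      simp only [U, Set.setOf_forall]
      refine isOpen_iInter_of_finite fun j => isOpen_lt (by fun_prop) continuous_const
    have hUc : Convex ℝ U := by
      intro x hx y hy p q hp hq hpq j
      have hx := hx j
      have hy := hy j
      simp only [Complex.add_re, Complex.real_smul, Complex.mul_re, Complex.ofReal_re,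
        Complex.ofReal_im, zero_mul, sub_zero]
      have : a j + (p * x.re + q * y.re) * b j
        = p * (a j + x.re * b j) + q * (a j + y.re * b j) := by
        linear_combination (-(a j)) * hpq
      rw [this]
      rcases hp.eq_or_lt with h | h
      · have : q = 1 := by linarith
        subst this; subst h; simpa using hy
      · nlinarith
    let F : ℂ → ℂ := fun z =>
      ∫ u, (Complex.exp (∑ j, ((a j : ℂ) + z * b j) * (u j : ℂ)) - 1) ∂m + V
    let G : ℂ → ℂ := fun z =>
      Complex.exp (t * psiC n c₀ c₁ μ (fun j => (a j : ℂ) + z * b j))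
    have hF : AnalyticOnNhd ℂ F U := by
      refine DifferentiableOn.analyticOnNhd (fun z hz => ?_) hUo
      exact ((gm.differentiableAt a b z hz).add_const V).differentiableWithinAt
    have hG : AnalyticOnNhd ℂ G U := by
      refine DifferentiableOn.analyticOnNhd (fun z hz => ?_) hUo
      refine DifferentiableAt.differentiableWithinAt ?_
      have h1 := gμ.differentiableAt a b z hz
      have h2 : DifferentiableAt ℂ (fun z : ℂ =>
          (c₀ : ℂ) + ∑ j, (c₁ j : ℂ) * ((a j : ℂ) + z * b j)) z := by fun_prop
      exact ((h2.add h1).const_mul (t : ℂ)).cexp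
    have h0U : (0 : ℂ) ∈ U := fun j => by simpa using hk j
    have hfreq : ∃ᶠ z in 𝓝[≠] (0 : ℂ), F z = G z := by
      have ht : Tendsto (fun r : ℝ => (r : ℂ)) (𝓝[≠] 0) (𝓝[≠] 0) := by
        refine tendsto_nhdsWithin_iff.2 ⟨?_, ?_⟩
        · have := (Complex.continuous_ofReal.tendsto 0).mono_left
            (nhdsWithin_le_nhds (s := {0}ᶜ))
          simpa using this
        · filter_upwards [self_mem_nhdsWithin] with r hr
          simpa using hr
      refine ht.frequently (Eventually.frequently ?_)
      have hev : ∀ᶠ z : ℂ in 𝓝[≠] 0, z ∈ U := nhdsWithin_le_nhds (hUo.mem_nhds h0U)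
      filter_upwards [ht.eventually hev] with r hr
      have := hreal (fun j => a j + r * b j) (fun j => by simpa using hr j)
      simpa [F, G] using this
    have hI := hF.eqOn_of_preconnected_of_frequently_eq hG hUc.isPreconnected h0U hfreq
      (show Complex.I ∈ U from fun j => by simpa using hk j)
    have hkk : ∀ j, (a j : ℂ) + Complex.I * b j = k j := fun j => by
      rw [mul_comm]; exact Complex.re_add_im (k j)
    simpa only [F, G, hkk] using hI
  rw [hsplit l hl]
  have t1 : Tendsto (fun e : ℝ => ∫ u, (Complex.exp (∑ j, (l j - (e : ℂ)) * (u j : ℂ)) - 1) ∂m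
      + V) (𝓝[>] 0) (𝓝 (∫ u, (Complex.exp (∑ j, l j * (u j : ℂ)) - 1) ∂m + V)) :=
    (gm.tendsto l hl).add_const V
  have t2 : Tendsto (fun e : ℝ => Complex.exp (t * psiC n c₀ c₁ μ (fun j => l j - (e : ℂ))))
      (𝓝[>] 0) (𝓝 (Complex.exp (t * psiC n c₀ c₁ μ l))) := by
    refine (Complex.continuous_exp.tendsto _).comp (Tendsto.const_mul _ ?_)
    refine Tendsto.add ?_ (gμ.tendsto l hl)
    have hc : Continuous fun e : ℝ => (c₀ : ℂ) + ∑ j, (c₁ j : ℂ) * (l j - (e : ℂ)) := by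
      fun_prop
    have := (hc.tendsto 0).mono_left (nhdsWithin_le_nhds (s := Set.Ioi 0))
    simpa using this
  refine tendsto_nhds_unique t1 (t2.congr' ?_)
  filter_upwards [self_mem_nhdsWithin] with e he
  have he : 0 < e := he
  refine (hint (fun j => l j - (e : ℂ)) fun j => ?_).symm
  have := hl j
  simp; linarith

theorem aux_sg {X : Type*} [NormedAddCommGroup X] [NormedSpace ℂ X]
    {T : ℝ → X →L[ℂ] X} {M : ℝ} (hT : IsC0Semigroup T) (hM : ∀ t, 0 ≤ t → ‖T t‖ ≤ M)
    {x : X} {l : ℂ} (h : InGenDomain T x (l • x)) (t : ℝ) (ht : 0 ≤ t) :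
    T t x = Complex.exp (l * t) • x := by
  obtain ⟨hT0, hTadd, hTc⟩ := hT
  have hM0 : 0 ≤ M := (norm_nonneg _).trans (hM 0 le_rfl)
  -- continuity
  have hcont : ∀ r ≥ 0, ∀ s ≥ 0, r ≤ s → ‖T s x - T r x‖ ≤ M * ‖T (s - r) x - x‖ := by
    intro r hr s hs hrs
    have h1 : T s = T r ∘L T (s - r) := by
      rw [← hTadd r (s - r) hr (by linarith)]; simp
    rw [h1]
    have : (T r ∘L T (s - r)) x - T r x = T r (T (s - r) x - x) := by simp
    rw [this]
    exact (T r).le_of_opNorm_le (hM r hr) _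
  have hcont' : ∀ r ≥ 0, ∀ s ≥ 0, ‖T s x - T r x‖ ≤ M * ‖T |s - r| x - x‖ := by
    intro r hr s hs
    rcases le_total r s with hrs | hrs
    · rw [abs_of_nonneg (by linarith)]; exact hcont r hr s hs hrs
    · rw [abs_of_nonpos (by linarith), neg_sub, norm_sub_rev]; exact hcont s hs r hr hrs
  have hTcont : ContinuousOn (fun s => T s x) (Set.Icc 0 t) := by
    intro r hr
    refine tendsto_iff_norm_sub_tendsto_zero.2 ?_
    have h1 : Tendsto (fun s : ℝ => |s - r|) (𝓝[Set.Icc 0 t] r) (𝓝[≥] 0) := by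
      refine tendsto_nhdsWithin_iff.2 ⟨?_, Eventually.of_forall fun s => Set.mem_Ici.2 (abs_nonneg _)⟩
      have hc : Continuous fun s : ℝ => |s - r| := by fun_prop
      have := (hc.tendsto r).mono_left (nhdsWithin_le_nhds (s := Set.Icc 0 t))
      simpa using this
    have h2 := (tendsto_iff_norm_sub_tendsto_zero.1 ((hTc x).comp h1)).const_mul M
    rw [mul_zero] at h2
    refine tendsto_of_tendsto_of_tendsto_of_le_of_le' tendsto_const_nhds h2
      (Eventually.of_forall fun s => norm_nonneg _) ?_
    filter_upwards [self_mem_nhdsWithin] with s hs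
    exact hcont' r hr.1 s hs.1
  have hTder : ∀ r ∈ Set.Ico 0 t, HasDerivWithinAt (fun s => T s x) (l • T r x) (Set.Ici r) r := by
    intro r hr
    rw [← hasDerivWithinAt_Ioi_iff_Ici, hasDerivWithinAt_iff_tendsto_slope' (by simp)]
    have h1 : Tendsto (fun s : ℝ => s - r) (𝓝[>] r) (𝓝[>] 0) := by
      refine tendsto_nhdsWithin_iff.2 ⟨?_, ?_⟩
      · have hc : Continuous fun s : ℝ => s - r := by fun_prop
        have := (hc.tendsto r).mono_left (nhdsWithin_le_nhds (s := Set.Ioi r))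
        simpa using this
      · filter_upwards [self_mem_nhdsWithin] with s hs
        simpa using hs
    have h2 := ((T r).continuous.tendsto _).comp (h.comp h1)
    rw [map_smul] at h2
    refine h2.congr' ?_
    filter_upwards [self_mem_nhdsWithin] with s hs
    have hs : r < s := hs
    have h3 : T s = T r ∘L T (s - r) := by
      rw [← hTadd r (s - r) hr.1 (by linarith)]; simp
    simp only [Function.comp, slope_def_module]
    rw [h3, ContinuousLinearMap.map_smul_of_tower]
    simp
  have hE : ∀ r : ℝ, HasDerivAt (fun s : ℝ => Complex.exp (-(l * s)))
      (Complex.exp (-(l * r)) * (-l)) r := by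
    intro r
    refine HasDerivAt.cexp ?_
    have := ((Complex.ofRealCLM.hasDerivAt (x := r)).const_mul l).fun_neg
    simpa using this
  have hconst := constant_of_has_deriv_right_zero (a := 0) (b := t)
    (f := fun s : ℝ => Complex.exp (-(l * s)) • T s x)
    (ContinuousOn.smul (by fun_prop) hTcont) (fun r hr => by
      have := ((hE r).hasDerivWithinAt (s := Set.Ici r)).fun_smul (hTder r hr)
      convert this using 1
      rw [smul_smul, ← add_smul]
      simp) t ⟨ht, le_rfl⟩
  simp only [hT0] at hconst
  have h5 : Complex.exp (l * t) • (Complex.exp (-(l * t)) • T t x) = T t x := by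
    rw [smul_smul, ← Complex.exp_add]; simp
  rw [← h5, hconst]
  simp

theorem aux_re_nonpos {X : Type*} [NormedAddCommGroup X] [NormedSpace ℂ X]
    {T : ℝ → X →L[ℂ] X} {M : ℝ} (hM : ∀ t, 0 ≤ t → ‖T t‖ ≤ M)
    {x : X} (hx : x ≠ 0) {l : ℂ} (h : ∀ t : ℝ, 0 ≤ t → T t x = Complex.exp (l * t) • x) :
    l.re ≤ 0 := by
  by_contra hl
  push Not at hl
  have hx0 : 0 < ‖x‖ := norm_pos_iff.2 hx
  have hM0 : 0 ≤ M := (norm_nonneg _).trans (hM 0 le_rfl)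
  have key : ∀ t : ℝ, 0 ≤ t → Real.exp (l.re * t) ≤ M := by
    intro t ht
    have h1 := (T t).le_of_opNorm_le (hM t ht) x
    rw [h t ht, norm_smul, Complex.norm_exp] at h1
    simpa using le_of_mul_le_mul_right h1 hx0
  have h2 := key (M / l.re) (by positivity)
  have h3 := Real.add_one_le_exp (l.re * (M / l.re))
  have h4 : l.re * (M / l.re) = M := by field_simp
  rw [h4] at h2 h3
  linarith

theorem aux_prod {X : Type*} [NormedAddCommGroup X] [NormedSpace ℂ X] (x : X) :
    ∀ {n : ℕ} (F : Fin n → X →L[ℂ] X) (c : Fin n → ℂ), (∀ j, F j x = c j • x) →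
      (List.ofFn F).prod x = (∏ j, c j) • x := by
  intro n
  induction n with
  | zero => intro F c _; simp
  | succ n ih =>
    intro F c h
    rw [List.ofFn_succ, List.prod_cons, ContinuousLinearMap.mul_apply,
      ih (fun j => F j.succ) (fun j => c j.succ) (fun j => h j.succ), map_smul, h 0,
      Fin.prod_univ_succ, smul_smul, mul_comm]

/-- For `ψ ∈ 𝒯ₙ` and pairwise commuting generators `A` of uniformly
bounded `C₀`-semigroups, `ψ` maps the joint point spectrum of `A` into the point
spectrum of `ψ(A)`: `σ_p(ψ(A)) ⊇ ψ(σ_p(A))`. More precisely, if `x ∈ D(A)`, `x ≠ 0`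
and `Aⱼ x = λⱼ x` for all `j`, then `x ∈ D(ψ(A))` and `ψ(A) x = ψ(λ) x`. -/
theorem image_jointPointSpectrum_subset_pointSpec
    {X : Type*} [NormedAddCommGroup X] [NormedSpace ℂ X] [CompleteSpace X]
    {n : ℕ} (T : Fin n → ℝ → X →L[ℂ] X) (M : Fin n → ℝ)
    (hT : ∀ j, IsC0Semigroup (T j)) (hM : ∀ j t, 0 ≤ t → ‖T j t‖ ≤ M j)
    (hcomm : ∀ i j s t, 0 ≤ s → 0 ≤ t → T i s ∘L T j t = T j t ∘L T i s)
    (ψ : (Fin n → ℝ) → ℝ) (c₀ : ℝ) (c₁ : Fin n → ℝ) (μ : MeasureTheory.Measure (Fin n → ℝ))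
    (hψ : MemTn n ψ) (hrep : HasLevyRep n ψ c₀ c₁ μ)
    (ν : ℝ → MeasureTheory.Measure (Fin n → ℝ)) (hν : IsSubordinator n ψ ν)
    (g : ℝ → X →L[ℂ] X) (hgsem : IsC0Semigroup g)
    (hg : ∀ t, 0 ≤ t → ∀ x : X, g t x = ∫ u, Tprod T u x ∂(ν t)) :
    (∀ (x : X), x ≠ 0 → ∀ l : Fin n → ℂ, (∀ j, InGenDomain (T j) x (l j • x)) →
        InGenDomain g x (psiC n c₀ c₁ μ l • x)) ∧
      psiC n c₀ c₁ μ '' JointPointSpectrum T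
        ⊆ PointSpec (fun x y : X => InGenDomain g x y) := by
  have main : ∀ (x : X), x ≠ 0 → ∀ l : Fin n → ℂ, (∀ j, InGenDomain (T j) x (l j • x)) →
        InGenDomain g x (psiC n c₀ c₁ μ l • x) := by
    intro x hx l hl
    have hTx : ∀ j (t : ℝ), 0 ≤ t → T j t x = Complex.exp (l j * t) • x := fun j t ht =>
      aux_sg (hT j) (hM j) (hl j) t ht
    have hre : ∀ j, (l j).re ≤ 0 := fun j => aux_re_nonpos (hM j) hx (hTx j)
    have hgx : ∀ t : ℝ, 0 ≤ t → g t x = Complex.exp (t * psiC n c₀ c₁ μ l) • x := by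
      intro t ht
      obtain ⟨hfin, h0, hm⟩ := hν t ht
      have hae : ∀ᵐ u ∂(ν t), ∀ j, 0 ≤ u j := h0
      rw [hg t ht x, ← aux_key hrep h0 t hm l hre, ← integral_smul_const]
      refine integral_congr_ae ?_
      filter_upwards [hae] with u hu
      rw [Tprod, aux_prod x _ (fun j => Complex.exp (l j * u j)) (fun j => hTx j _ (hu j)),
        Complex.exp_sum]
    set p := psiC n c₀ c₁ μ l with hp
    have hd : HasDerivAt (fun s : ℝ => Complex.exp (s * p)) p 0 := by
      have h1 := (Complex.ofRealCLM.hasDerivAt (x := (0 : ℝ))).mul_const p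
      have h2 := h1.cexp
      simpa using h2
    have h2 := hd.hasDerivWithinAt (s := Set.Ioi 0)
    rw [hasDerivWithinAt_iff_tendsto_slope' (by simp)] at h2
    have h3 := h2.smul_const x
    refine h3.congr' ?_
    filter_upwards [self_mem_nhdsWithin] with s hs
    have hs : 0 < s := hs
    rw [hgx s hs.le, slope_def_module, smul_assoc, sub_smul]
    simp
  refine ⟨main, ?_⟩
  rintro _ ⟨l, ⟨x, hx, h⟩, rfl⟩
  exact ⟨x, hx, main x hx l h⟩
end
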